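/- arXiv:2402.00542 — 2 statements merged into one kernel-verified Lean document; each statement's English description precedes it below -/
import Mathlib

section
/- For all A, B ⊆ X = {x_1,…,x_n} with |A| ≥ 4, |B| ≥ 4 and |A△B| ≥ 4, and all orderings σ_a of A and σ_b of B, the Tseitin graph of rAddPar(a,b) — the graph whose vertices are the xor constraints of rAddPar(a,b), with two constraints adjacent whenever they share a variable — is isomorphic to the graph obtained from H by contracting six edges, namely the first and the last edge of each of the three layer paths of H (merging parallel edges). In particular, the treewidth of the Tseitin graph of rAddPar(a,b) is at least tw(H) − 6. -/
abbrev Lit (ν : Type) := ν × Bool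
abbrev Clause (ν : Type) := Finset (ν × Bool)
abbrev CNF (ν : Type) := Finset (Finset (ν × Bool))

variable {ν : Type} [DecidableEq ν]

/-- Negation of a literal. -/
def negLit (l : Lit ν) : Lit ν := (l.1, !l.2)

/-- Canonical CNF encoding of the parity constraint `l₁ ⊕ ⋯ ⊕ l_k = c` for the
literals in the list `ls`: the clauses forbid exactly the assignments under which
the number of true literals among `ls` has parity different from `c`. -/
def parityCNF (ls : List (Lit ν)) (c : Bool) : CNF ν :=
  ((Finset.univ : Finset (Fin ls.length → Bool)).filter
      (fun f => (Finset.univ.filter (fun i => f i = true)).card % 2 = (if c then 0 else 1))).image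
    (fun f => Finset.univ.image (fun i => if f i then negLit (ls.get i) else ls.get i))

/-- `xor(l₁,…,l_k)`: canonical CNF encoding of `l₁ ⊕ ⋯ ⊕ l_k = 0`. -/
def xorCNF (ls : List (Lit ν)) : CNF ν := parityCNF ls false

def clauseSat (τ : ν → Bool) (C : Clause ν) : Prop := ∃ l ∈ C, τ l.1 = l.2

def cnfSat (τ : ν → Bool) (F : CNF ν) : Prop := ∀ C ∈ F, clauseSat τ C

def Unsat (F : CNF ν) : Prop := ¬ ∃ τ : ν → Bool, cnfSat τ F

def cnfVars (F : CNF ν) : Set ν := {v | ∃ C ∈ F, ∃ b, (v, b) ∈ C}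

def clauseVars (C : Clause ν) : Set ν := {v | ∃ b, (v, b) ∈ C}

/-- `R` is the resolvent of `C` and `D`. -/
def IsResolvent (C D R : Clause ν) : Prop :=
  ∃ v : ν, (v, true) ∈ C ∧ (v, false) ∈ D ∧ R = C.erase (v, true) ∪ D.erase (v, false)

/-- A resolution refutation of `F`: a sequence of clauses, each an axiom of `F` or a
resolvent of two earlier clauses, ending with the empty clause. Its length is `L.length`. -/
def IsResRefutation (F : CNF ν) (L : List (Clause ν)) : Prop :=
  L ≠ [] ∧ L.getLast? = some (∅ : Clause ν) ∧
    ∀ i, (hi : i < L.length) →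
      L[i] ∈ F ∨ ∃ j k, ∃ (hj : j < i) (hk : k < i),
        IsResolvent (L[j]'(hj.trans hi)) (L[k]'(hk.trans hi)) L[i]

/-- The `j`-th xor constraint (0-based) of `Parity(xs, t)`: for a list `xs` of `n ≥ 4`
literals and Tseitin variables `t 0, …, t (n-4)`, constraint `0` is
`xor(xs[0], xs[1], t 0)`, constraint `j` for `1 ≤ j ≤ n-4` is
`xor(t (j-1), xs[j+1], t j)`, and constraint `n-3` is `xor(t (n-4), xs[n-2], xs[n-1])`. -/
def parityCtr (xs : List (Lit ν)) (t : ℕ → ν) (j : ℕ) : List (Lit ν) :=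
  if j = 0 then [xs.getD 0 (t 0, true), xs.getD 1 (t 0, true), (t 0, true)]
  else if j < xs.length - 3 then [(t (j - 1), true), xs.getD (j + 1) (t 0, true), (t j, true)]
  else [(t (xs.length - 4), true), xs.getD (xs.length - 2) (t 0, true),
    xs.getD (xs.length - 1) (t 0, true)]

/-- The standard linear CNF encoding `Parity(xs, t)` of the parity constraint
`xs[0] ⊕ ⋯ ⊕ xs[n-1] = 0` using Tseitin variables `t 0, …, t (n-4)`. -/
def ParityCNF (xs : List (Lit ν)) (t : ℕ → ν) : CNF ν :=
  (Finset.range (xs.length - 2)).biUnion (fun j => xorCNF (parityCtr xs t j))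

/-- The elements of `A` listed in the order induced by the permutation `σ`. -/
def orderedElems {n : ℕ} (A : Finset (Fin n)) (σ : Equiv.Perm (Fin n)) : List (Fin n) :=
  (List.ofFn (fun i => σ i)).filter (fun i => decide (i ∈ A))

/-- Positive literals for a list of variables, variable `i : Fin n` encoded as `(i : ℕ)`. -/
def posLits {n : ℕ} (l : List (Fin n)) : List (Lit ℕ) := l.map (fun i => ((i : ℕ), true))

/-- The literals of `C`: the symmetric difference `A △ B` in the order induced by `σc`,
all positive except that the literal on the maximal element of `A △ B` is flipped. -/
def symmLits {n : ℕ} (A B : Finset (Fin n)) (σc : Equiv.Perm (Fin n)) : List (Lit ℕ) :=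
  (orderedElems (symmDiff A B) σc).map
    (fun (i : Fin n) => ((i : ℕ), decide ((i : WithBot (Fin n)) ≠ (symmDiff A B).max)))

/-- `rAddPar(a, b, σc) = Parity(A, S, σa) ∧ Parity(B, T, σb) ∧ Parity(C, U, σc)` where
`C` is `A △ B` with one literal flipped; `S`, `T`, `U` are encoded as `n + k`, `2n + k`,
`3n + k` respectively. -/
def rAddPar (n : ℕ) (A B : Finset (Fin n)) (σa σb σc : Equiv.Perm (Fin n)) : CNF ℕ :=
  ParityCNF (posLits (orderedElems A σa)) (fun k => n + k) ∪
    ParityCNF (posLits (orderedElems B σb)) (fun k => 2 * n + k) ∪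
    ParityCNF (symmLits A B σc) (fun k => 3 * n + k)

/-- The constituent xor constraints of `rAddPar(a, b, σc)` (as lists of literals),
indexed by the disjoint sum of the constraint indices of the three parity encodings. -/
def rAddParCtr (n : ℕ) (A B : Finset (Fin n)) (σa σb σc : Equiv.Perm (Fin n)) :
    Fin (A.card - 2) ⊕ Fin (B.card - 2) ⊕ Fin ((symmDiff A B).card - 2) → List (Lit ℕ)
  | Sum.inl j => parityCtr (posLits (orderedElems A σa)) (fun k => n + k) j
  | Sum.inr (Sum.inl j) => parityCtr (posLits (orderedElems B σb)) (fun k => 2 * n + k) j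
  | Sum.inr (Sum.inr j) => parityCtr (symmLits A B σc) (fun k => 3 * n + k) j

/-- The Tseitin graph of `rAddPar(a, b)` (with `σc = id`): vertices are the xor
constraints, two constraints being adjacent whenever they share a variable. -/
def rAddParTseitinGraph (n : ℕ) (A B : Finset (Fin n)) (σa σb : Equiv.Perm (Fin n)) :
    SimpleGraph (Fin (A.card - 2) ⊕ Fin (B.card - 2) ⊕ Fin ((symmDiff A B).card - 2)) :=
  SimpleGraph.fromRel (fun a b =>
    ∃ v : ℕ, v ∈ (rAddParCtr n A B σa σb (Equiv.refl (Fin n)) a).map Prod.fst ∧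
      v ∈ (rAddParCtr n A B σa σb (Equiv.refl (Fin n)) b).map Prod.fst)

/-- `(T, bag)` is a tree decomposition of the graph `G`. -/
def IsTreeDecomp {V ι : Type} (G : SimpleGraph V) (T : SimpleGraph ι)
    (bag : ι → Finset V) : Prop :=
  T.IsTree ∧ (∀ v : V, ∃ i, v ∈ bag i) ∧
    (∀ u v : V, G.Adj u v → ∃ i, u ∈ bag i ∧ v ∈ bag i) ∧
    (∀ v : V, (T.induce {i | v ∈ bag i}).Connected)

/-- The treewidth of a finite simple graph: the least `w` such that `G` has a tree
decomposition all of whose bags have at most `w + 1` vertices. -/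
noncomputable def treewidth {V : Type} [Fintype V] [DecidableEq V] (G : SimpleGraph V) : ℕ :=
  sInf {w | ∃ (ι : Type) (T : SimpleGraph ι) (bag : ι → Finset V),
    IsTreeDecomp G T bag ∧ ∀ i, (bag i).card ≤ w + 1}

/-- The graph obtained from `G` by contracting the edge `uv`, merging `v` into `u`
(and merging parallel edges); the vertex `v` becomes isolated. -/
def contract {V : Type} [DecidableEq V] (G : SimpleGraph V) (u v : V) : SimpleGraph V :=
  SimpleGraph.fromRel (fun a b =>
    ∃ a' b', G.Adj a' b' ∧ (if a' = v then u else a') = a ∧ (if b' = v then u else b') = b)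

/-- `a` and `b` are consecutive elements of the list `l`. -/
def consec {α : Type} (l : List α) (a b : α) : Prop :=
  ∃ k : ℕ, l[k]? = some a ∧ l[k + 1]? = some b

/-- The three-layer graph `H` on `V ∪ V' ∪ V''` where `V = A`, `V' = B`,
`V'' = A △ B`: a path through each layer (in the orders `σa`, `σb` and increasing
index order respectively) together with the matching edges `(i, i')` for
`x_i ∈ A ∩ B`, `(i, i'')` for `x_i ∈ A ∖ B` and `(i', i'')` for `x_i ∈ B ∖ A`. -/
def Hgraph (n : ℕ) (A B : Finset (Fin n)) (σa σb : Equiv.Perm (Fin n)) :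
    SimpleGraph ({i // i ∈ A} ⊕ {i // i ∈ B} ⊕ {i // i ∈ symmDiff A B}) :=
  SimpleGraph.fromRel (fun a b =>
    match a, b with
    | Sum.inl i, Sum.inl j => consec (orderedElems A σa) i.1 j.1
    | Sum.inr (Sum.inl i), Sum.inr (Sum.inl j) => consec (orderedElems B σb) i.1 j.1
    | Sum.inr (Sum.inr i), Sum.inr (Sum.inr j) =>
        consec (orderedElems (symmDiff A B) (Equiv.refl (Fin n))) i.1 j.1
    | Sum.inl i, Sum.inr (Sum.inl j) => i.1 = j.1
    | Sum.inl i, Sum.inr (Sum.inr j) => i.1 = j.1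
    | Sum.inr (Sum.inl i), Sum.inr (Sum.inr j) => i.1 = j.1
    | _, _ => False)

section Aux

theorem orderedElems_nodup {n : ℕ} (S : Finset (Fin n)) (σ : Equiv.Perm (Fin n)) :
    (orderedElems S σ).Nodup := by
  unfold orderedElems
  exact (List.nodup_ofFn.2 σ.injective).filter _

theorem mem_orderedElems {n : ℕ} (S : Finset (Fin n)) (σ : Equiv.Perm (Fin n)) (x : Fin n) :
    x ∈ orderedElems S σ ↔ x ∈ S := by
  unfold orderedElems
  simp only [List.mem_filter, List.mem_ofFn, decide_eq_true_eq]
  exact ⟨fun h => h.2, fun h => ⟨⟨σ.symm x, by simp⟩, h⟩⟩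

theorem length_orderedElems {n : ℕ} (S : Finset (Fin n)) (σ : Equiv.Perm (Fin n)) :
    (orderedElems S σ).length = S.card := by
  rw [← List.toFinset_card_of_nodup (orderedElems_nodup S σ)]
  congr 1
  ext x
  simp [mem_orderedElems]

/-- The `k`-th element of a layer. -/
def layerPt {n : ℕ} (S : Finset (Fin n)) (σ : Equiv.Perm (Fin n)) (k : Fin S.card) :
    {i // i ∈ S} :=
  ⟨(orderedElems S σ)[k.1]'(by rw [length_orderedElems]; exact k.2),
    (mem_orderedElems S σ _).1 (List.getElem_mem _)⟩

theorem layerPt_bij {n : ℕ} (S : Finset (Fin n)) (σ : Equiv.Perm (Fin n)) :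
    Function.Bijective (layerPt S σ) := by
  rw [Fintype.bijective_iff_injective_and_card]
  refine ⟨fun a b h => ?_, by simp⟩
  have h' := congrArg Subtype.val h
  simp only [layerPt] at h'
  exact Fin.ext ((orderedElems_nodup S σ).getElem_inj_iff.1 h')

theorem layerPt_get {n : ℕ} (S : Finset (Fin n)) (σ : Equiv.Perm (Fin n)) (k : ℕ)
    (hk : k < S.card) : (orderedElems S σ)[k]? = some (layerPt S σ ⟨k, hk⟩).1 := by
  simp [layerPt]

theorem consec_layerPt {n : ℕ} (S : Finset (Fin n)) (σ : Equiv.Perm (Fin n))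
    (p q : Fin S.card) :
    consec (orderedElems S σ) (layerPt S σ p).1 (layerPt S σ q).1 ↔ p.1 + 1 = q.1 := by
  have hn := orderedElems_nodup S σ
  have hl := length_orderedElems S σ
  constructor
  · rintro ⟨k, h1, h2⟩
    obtain ⟨h1a, h1b⟩ := List.getElem?_eq_some_iff.1 h1
    obtain ⟨h2a, h2b⟩ := List.getElem?_eq_some_iff.1 h2
    have e1 : k = p.1 := hn.getElem_inj_iff.1 h1b
    have e2 : k + 1 = q.1 := hn.getElem_inj_iff.1 h2b
    omega
  · intro h
    refine ⟨p.1, layerPt_get S σ p.1 p.2, ?_⟩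
    have := layerPt_get S σ q.1 q.2
    rw [h]; exact this

/-- Collapsing the first two and the last two positions. -/
def clampIdx (m : ℕ) (h : 4 ≤ m) (p : Fin m) : Fin (m - 2) :=
  ⟨max 1 (min p.1 (m - 2)) - 1, by omega⟩

/-- Surviving positions. -/
def embIdx (m : ℕ) (j : Fin (m - 2)) : Fin m := ⟨j.1 + 1, by omega⟩

theorem embIdx_inj (m : ℕ) : Function.Injective (embIdx m) := by
  intro a b h
  simp only [embIdx, Fin.mk.injEq] at h
  exact Fin.ext (by omega)

theorem clampIdx_embIdx (m : ℕ) (h : 4 ≤ m) (j : Fin (m - 2)) :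
    clampIdx m h (embIdx m j) = j := by
  apply Fin.ext
  simp only [clampIdx, embIdx]
  omega

theorem mem_parityCtr (xs : List (Lit ℕ)) (t : ℕ → ℕ) (m : ℕ) (hm : 4 ≤ m)
    (hl : xs.length = m) (j : Fin (m - 2)) (v : ℕ) :
    v ∈ (parityCtr xs t j.1).map Prod.fst ↔
      (∃ k : Fin m, (xs[k.1]'(by rw [hl]; exact k.2)).1 = v ∧ clampIdx m hm k = j) ∨
      (∃ k, k ≤ m - 4 ∧ v = t k ∧ (k = j.1 ∨ k + 1 = j.1)) := by
  subst hl
  obtain ⟨j, hj⟩ := j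
  have gd : ∀ k (hk : k < xs.length), xs.getD k (t 0, true) = xs[k] := by
    intro k hk; simp [hk]
  unfold parityCtr
  simp only [clampIdx, Fin.mk.injEq]
  split_ifs with h1 h2
  · rw [gd 0 (by omega), gd 1 (by omega)]
    simp only [List.map_cons, List.map_nil, List.mem_cons, List.not_mem_nil, or_false]
    constructor
    · rintro (h | h | h)
      · exact Or.inl ⟨⟨0, by omega⟩, h.symm, by simp; omega⟩
      · exact Or.inl ⟨⟨1, by omega⟩, h.symm, by simp; omega⟩
      · exact Or.inr ⟨0, by omega, h, by omega⟩
    · rintro (⟨⟨k, hk⟩, rfl, h⟩ | ⟨k, hk, rfl, h⟩)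
      · have : k = 0 ∨ k = 1 := by simp at h; omega
        rcases this with rfl | rfl <;> simp
      · have : k = 0 := by omega
        subst this; simp
  · rw [gd (j+1) (by omega)]
    simp only [List.map_cons, List.map_nil, List.mem_cons, List.not_mem_nil, or_false]
    constructor
    · rintro (h | h | h)
      · exact Or.inr ⟨j - 1, by omega, h, by omega⟩
      · exact Or.inl ⟨⟨j + 1, by omega⟩, h.symm, by simp; omega⟩
      · exact Or.inr ⟨j, by omega, h, by omega⟩
    · rintro (⟨⟨k, hk⟩, rfl, h⟩ | ⟨k, hk, rfl, h⟩)
      · have : k = j + 1 := by simp at h; omega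
        subst this; simp
      · have : k = j ∨ k = j - 1 := by omega
        rcases this with rfl | rfl <;> simp
  · rw [gd (xs.length - 2) (by omega), gd (xs.length - 1) (by omega)]
    simp only [List.map_cons, List.map_nil, List.mem_cons, List.not_mem_nil, or_false]
    constructor
    · rintro (h | h | h)
      · exact Or.inr ⟨xs.length - 4, by omega, h, by omega⟩
      · exact Or.inl ⟨⟨xs.length - 2, by omega⟩, h.symm, by simp; omega⟩
      · exact Or.inl ⟨⟨xs.length - 1, by omega⟩, h.symm, by simp; omega⟩
    · rintro (⟨⟨k, hk⟩, rfl, h⟩ | ⟨k, hk, rfl, h⟩)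
      · have : k = xs.length - 2 ∨ k = xs.length - 1 := by simp at h; omega
        rcases this with rfl | rfl <;> simp
      · have : k = xs.length - 4 := by omega
        subst this; simp

/-- Description of the variables of constraint `j` of a layer. -/
def ctrVar {n : ℕ} (S : Finset (Fin n)) (σ : Equiv.Perm (Fin n)) (h : 4 ≤ S.card)
    (t : ℕ) (j : Fin (S.card - 2)) (v : ℕ) : Prop :=
  (∃ k : Fin S.card, ((layerPt S σ k).1 : ℕ) = v ∧ clampIdx S.card h k = j) ∨
  (∃ k, k ≤ S.card - 4 ∧ v = t + k ∧ (k = j.1 ∨ k + 1 = j.1))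

theorem posLits_eq {n : ℕ} (l : List (Fin n)) :
    posLits l = l.map (fun i : Fin n => ((i : ℕ), true)) := by
  induction l with
  | nil => rfl
  | cons a l ih =>
    rw [List.map_cons, ← ih]
    simp [posLits]

theorem mem_pos {n : ℕ} (S : Finset (Fin n)) (σ : Equiv.Perm (Fin n)) (h : 4 ≤ S.card)
    (t : ℕ) (j : Fin (S.card - 2)) (v : ℕ) :
    v ∈ (parityCtr (posLits (orderedElems S σ)) (fun k => t + k) j.1).map Prod.fst ↔
      ctrVar S σ h t j v := by
  rw [mem_parityCtr _ _ S.card h (by simp [posLits_eq, length_orderedElems])]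
  simp only [ctrVar, layerPt, posLits_eq, List.getElem_map]

theorem mem_symm {n : ℕ} (A B : Finset (Fin n)) (σ : Equiv.Perm (Fin n))
    (h : 4 ≤ (symmDiff A B).card)
    (t : ℕ) (j : Fin ((symmDiff A B).card - 2)) (v : ℕ) :
    v ∈ (parityCtr (symmLits A B σ) (fun k => t + k) j.1).map Prod.fst ↔
      ctrVar (symmDiff A B) σ h t j v := by
  rw [mem_parityCtr _ _ (symmDiff A B).card h (by simp [symmLits, length_orderedElems])]
  simp [ctrVar, layerPt, symmLits]

theorem same_layer {n : ℕ} (S : Finset (Fin n)) (σ : Equiv.Perm (Fin n)) (h : 4 ≤ S.card)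
    (t : ℕ) (ht : n ≤ t) (i j : Fin (S.card - 2)) (hij : i ≠ j) :
    (∃ v, ctrVar S σ h t i v ∧ ctrVar S σ h t j v) ↔
      ∃ p q : Fin S.card, (p.1 + 1 = q.1 ∨ q.1 + 1 = p.1) ∧
        clampIdx S.card h p = i ∧ clampIdx S.card h q = j := by
  have hij' : i.1 ≠ j.1 := fun h => hij (Fin.ext h)
  have hi := i.2
  have hj := j.2
  trans (i.1 + 1 = j.1 ∨ j.1 + 1 = i.1)
  · constructor
    · rintro ⟨v, ⟨k, hk, hk'⟩ | ⟨k, hk, hk', hk''⟩, ⟨l, hl, hl'⟩ | ⟨l, hl, hl', hl''⟩⟩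
      · exfalso
        have : layerPt S σ k = layerPt S σ l := Subtype.ext (Fin.ext (hk.trans hl.symm))
        have := (layerPt_bij S σ).1 this
        subst this
        exact hij (hk'.symm.trans hl')
      · have := (layerPt S σ k).1.2
        omega
      · have := (layerPt S σ l).1.2
        omega
      · omega
    · rintro (h1 | h1)
      · exact ⟨t + i.1, Or.inr ⟨i.1, by omega, rfl, by omega⟩,
          Or.inr ⟨i.1, by omega, rfl, by omega⟩⟩
      · exact ⟨t + j.1, Or.inr ⟨j.1, by omega, rfl, by omega⟩,
          Or.inr ⟨j.1, by omega, rfl, by omega⟩⟩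
  · constructor
    · intro h1
      refine ⟨embIdx _ i, embIdx _ j, ?_, clampIdx_embIdx _ _ _, clampIdx_embIdx _ _ _⟩
      simp only [embIdx]; omega
    · rintro ⟨p, q, h1, rfl, rfl⟩
      simp only [clampIdx] at *
      omega

theorem cross_layer {n : ℕ} (S S' : Finset (Fin n)) (σ σ' : Equiv.Perm (Fin n))
    (h : 4 ≤ S.card) (h' : 4 ≤ S'.card)
    (t t' : ℕ) (ht : n ≤ t) (ht' : t + n ≤ t') (i : Fin (S.card - 2)) (j : Fin (S'.card - 2)) :
    (∃ v, ctrVar S σ h t i v ∧ ctrVar S' σ' h' t' j v) ↔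
      ∃ (p : Fin S.card) (q : Fin S'.card), (layerPt S σ p).1 = (layerPt S' σ' q).1 ∧
        clampIdx S.card h p = i ∧ clampIdx S'.card h' q = j := by
  have hS : S.card ≤ n := by simpa using S.card_le_univ
  constructor
  · rintro ⟨v, ⟨k, hk, hk'⟩ | ⟨k, hk, hk', hk''⟩, ⟨l, hl, hl'⟩ | ⟨l, hl, hl', hl''⟩⟩
    · exact ⟨k, l, Fin.ext (hk.trans hl.symm), hk', hl'⟩
    · have := (layerPt S σ k).1.2
      omega
    · have := (layerPt S' σ' l).1.2
      omega
    · omega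
  · rintro ⟨p, q, h1, h2, h3⟩
    exact ⟨_, Or.inl ⟨p, rfl, h2⟩, Or.inl ⟨q, by rw [h1], h3⟩⟩

/-- Image of a graph under a vertex map (loops removed). -/
def imgGraph {V : Type} (G : SimpleGraph V) (f : V → V) : SimpleGraph V :=
  SimpleGraph.fromRel (fun a b => ∃ a' b', G.Adj a' b' ∧ f a' = a ∧ f b' = b)

theorem imgGraph_adj {V : Type} (G : SimpleGraph V) (f : V → V) (a b : V) :
    (imgGraph G f).Adj a b ↔ a ≠ b ∧ ∃ a' b', G.Adj a' b' ∧ f a' = a ∧ f b' = b := by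
  unfold imgGraph
  rw [SimpleGraph.fromRel_adj]
  refine and_congr_right fun _ => ⟨?_, Or.inl⟩
  rintro (h | ⟨a', b', h, h1, h2⟩)
  · exact h
  · exact ⟨b', a', h.symm, h2, h1⟩

/-- The vertex map of a contraction. -/
def mergeMap {V : Type} [DecidableEq V] (u v : V) (x : V) : V := if x = v then u else x

theorem contract_eq {V : Type} [DecidableEq V] (G : SimpleGraph V) (u v : V) :
    contract G u v = imgGraph G (mergeMap u v) := rfl

theorem contract_imgGraph {V : Type} [DecidableEq V] (G : SimpleGraph V) (f : V → V) (u v : V) :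
    contract (imgGraph G f) u v = imgGraph G (fun x => mergeMap u v (f x)) := by
  ext a b
  rw [contract_eq, imgGraph_adj, imgGraph_adj]
  refine and_congr_right fun hab => ?_
  constructor
  · rintro ⟨a', b', h, h1, h2⟩
    rw [imgGraph_adj] at h
    obtain ⟨_, a'', b'', h, rfl, rfl⟩ := h
    exact ⟨a'', b'', h, h1, h2⟩
  · rintro ⟨a', b', h, h1, h2⟩
    refine ⟨f a', f b', ?_, h1, h2⟩
    rw [imgGraph_adj]
    refine ⟨?_, a', b', h, rfl, rfl⟩
    intro he
    rw [he] at h1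
    exact hab (h1.symm.trans h2)

theorem treewidth_le_add {V W : Type} [Fintype V] [DecidableEq V] [Fintype W] [DecidableEq W]
    (G : SimpleGraph V) (K : SimpleGraph W) (e : W ↪ V) (S : Finset V)
    (hS : ∀ v, v ∈ S ∨ ∃ w, e w = v) (hdis : ∀ w, e w ∉ S)
    (hadj : ∀ u v, G.Adj (e u) (e v) → K.Adj u v) :
    treewidth G ≤ treewidth K + S.card := by
  have hne : {w | ∃ (ι : Type) (T : SimpleGraph ι) (bag : ι → Finset W),
    IsTreeDecomp K T bag ∧ ∀ i, (bag i).card ≤ w + 1}.Nonempty := by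
    refine ⟨Fintype.card W, Unit, ⊥, fun _ => Finset.univ, ⟨?_, ?_, ?_, ?_⟩, ?_⟩
    · exact SimpleGraph.IsTree.of_subsingleton
    · simp
    · simp
    · intro v
      have : Nonempty {i : Unit | v ∈ (Finset.univ : Finset W)} := ⟨⟨(), by simp⟩⟩
      exact SimpleGraph.Connected.of_subsingleton
    · intro i
      simp [Finset.card_univ]
  obtain ⟨ι, T, bag, ⟨hT, hv, he, hc⟩, hcard⟩ := Nat.sInf_mem hne
  refine Nat.sInf_le ⟨ι, T, fun i => (bag i).map e ∪ S, ⟨hT, ?_, ?_, ?_⟩, ?_⟩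
  · intro v
    rcases hS v with h | ⟨w, rfl⟩
    · obtain ⟨i⟩ := hT.1.nonempty
      exact ⟨i, by simp [h]⟩
    · obtain ⟨i, hi⟩ := hv w
      exact ⟨i, by simp [hi]⟩
  · intro u v huv
    rcases hS u with h | ⟨w, rfl⟩
    · rcases hS v with h' | ⟨w', rfl⟩
      · obtain ⟨i⟩ := hT.1.nonempty
        exact ⟨i, by simp [h], by simp [h']⟩
      · obtain ⟨i, hi⟩ := hv w'
        exact ⟨i, by simp [h], by simp [hi]⟩
    · rcases hS v with h' | ⟨w', rfl⟩
      · obtain ⟨i, hi⟩ := hv w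
        exact ⟨i, by simp [hi], by simp [h']⟩
      · obtain ⟨i, hi, hi'⟩ := he _ _ (hadj _ _ huv)
        exact ⟨i, by simp [hi], by simp [hi']⟩
  · intro v
    rcases hS v with h | ⟨w, rfl⟩
    · have : {i | v ∈ (bag i).map e ∪ S} = Set.univ := by
        ext i; simp [h]
      rw [this]
      exact (SimpleGraph.induceUnivIso T).connected_iff.2 hT.1
    · have : {i | e w ∈ (bag i).map e ∪ S} = {i | w ∈ bag i} := by
        ext i; simp [hdis w]
      rw [this]
      exact hc w
  · intro i
    have h1 := Finset.card_union_le ((bag i).map e) S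
    have h2 := hcard i
    rw [Finset.card_map] at h1
    change ((bag i).map e ∪ S).card ≤ treewidth K + S.card + 1
    change (bag i).card ≤ treewidth K + 1 at h2
    omega

/-- Map all three layers. -/
def sumMap3 {α β γ α' β' γ' : Type} (f : α → α') (g : β → β') (h : γ → γ') :
    α ⊕ β ⊕ γ → α' ⊕ β' ⊕ γ' := Sum.map f (Sum.map g h)

/-- Index version of the layered graph relation. -/
def idxRel {n : ℕ} (A B C : Finset (Fin n)) (σa σb σc : Equiv.Perm (Fin n)) :
    Fin A.card ⊕ Fin B.card ⊕ Fin C.card → Fin A.card ⊕ Fin B.card ⊕ Fin C.card → Prop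
  | Sum.inl p, Sum.inl q => p.1 + 1 = q.1 ∨ q.1 + 1 = p.1
  | Sum.inr (Sum.inl p), Sum.inr (Sum.inl q) => p.1 + 1 = q.1 ∨ q.1 + 1 = p.1
  | Sum.inr (Sum.inr p), Sum.inr (Sum.inr q) => p.1 + 1 = q.1 ∨ q.1 + 1 = p.1
  | Sum.inl p, Sum.inr (Sum.inl q) => (layerPt A σa p).1 = (layerPt B σb q).1
  | Sum.inl p, Sum.inr (Sum.inr q) => (layerPt A σa p).1 = (layerPt C σc q).1
  | Sum.inr (Sum.inl p), Sum.inr (Sum.inr q) => (layerPt B σb p).1 = (layerPt C σc q).1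
  | Sum.inr (Sum.inl p), Sum.inl q => (layerPt A σa q).1 = (layerPt B σb p).1
  | Sum.inr (Sum.inr p), Sum.inl q => (layerPt A σa q).1 = (layerPt C σc p).1
  | Sum.inr (Sum.inr p), Sum.inr (Sum.inl q) => (layerPt B σb q).1 = (layerPt C σc p).1

theorem Hgraph_adj_idx (n : ℕ) (A B : Finset (Fin n)) (σa σb : Equiv.Perm (Fin n))
    (p q : Fin A.card ⊕ Fin B.card ⊕ Fin (symmDiff A B).card) :
    (Hgraph n A B σa σb).Adj
      (sumMap3 (layerPt A σa) (layerPt B σb) (layerPt (symmDiff A B) (Equiv.refl (Fin n))) p)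
      (sumMap3 (layerPt A σa) (layerPt B σb) (layerPt (symmDiff A B) (Equiv.refl (Fin n))) q) ↔
    idxRel A B (symmDiff A B) σa σb (Equiv.refl (Fin n)) p q := by
  have key : ∀ (S : Finset (Fin n)) (σ : Equiv.Perm (Fin n)) (p q : Fin S.card),
      (¬ layerPt S σ p = layerPt S σ q ∧ (p.1 + 1 = q.1 ∨ q.1 + 1 = p.1)) ↔
        (p.1 + 1 = q.1 ∨ q.1 + 1 = p.1) := by
    intro S σ p q
    refine and_iff_right_of_imp fun h he => ?_
    have := (layerPt_bij S σ).1 he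
    subst this
    omega
  unfold Hgraph
  rw [SimpleGraph.fromRel_adj]
  rcases p with p | p | p <;> rcases q with q | q | q <;>
    simp [sumMap3, idxRel, consec_layerPt, key]

theorem tseitin_adj_idx (n : ℕ) (A B : Finset (Fin n))
    (hA : 4 ≤ A.card) (hB : 4 ≤ B.card) (hC : 4 ≤ (symmDiff A B).card)
    (σa σb : Equiv.Perm (Fin n))
    (i j : Fin (A.card - 2) ⊕ Fin (B.card - 2) ⊕ Fin ((symmDiff A B).card - 2)) :
    (rAddParTseitinGraph n A B σa σb).Adj i j ↔ i ≠ j ∧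
      ∃ p q, idxRel A B (symmDiff A B) σa σb (Equiv.refl (Fin n)) p q ∧
        sumMap3 (clampIdx _ hA) (clampIdx _ hB) (clampIdx _ hC) p = i ∧
        sumMap3 (clampIdx _ hA) (clampIdx _ hB) (clampIdx _ hC) q = j := by
  unfold rAddParTseitinGraph
  rw [SimpleGraph.fromRel_adj]
  refine and_congr_right fun hij => ?_
  have hsym : ∀ P Q : ℕ → Prop, ((∃ v, P v ∧ Q v) ∨ (∃ v, Q v ∧ P v)) ↔ ∃ v, P v ∧ Q v := by
    intro P Q
    exact ⟨fun h => h.elim id fun ⟨v, h1, h2⟩ => ⟨v, h2, h1⟩, Or.inl⟩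
  rw [hsym]
  rcases i with i | i | i <;> rcases j with j | j | j <;>
    simp only [rAddParCtr, mem_pos _ _ hA, mem_pos _ _ hB, mem_symm _ _ _ hC]
  · rw [same_layer _ _ _ _ (by omega) _ _ (by simpa using hij)]
    simp [sumMap3, idxRel]
  · rw [cross_layer _ _ _ _ _ _ _ _ (by omega) (by omega)]
    simp [sumMap3, idxRel]
  · rw [cross_layer _ _ _ _ _ _ _ _ (by omega) (by omega)]
    simp [sumMap3, idxRel]
  · simp only [and_comm (a := ctrVar B _ _ _ _ _)]
    rw [cross_layer _ _ _ _ _ _ _ _ (by omega) (by omega)]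
    simp only [sumMap3, idxRel, Sum.exists, Sum.map_inl, Sum.map_inr]
    simp
    rw [exists_comm]
    simp only [and_comm (a := clampIdx A.card _ _ = _)]
  · rw [same_layer _ _ _ _ (by omega) _ _ (by simpa using hij)]
    simp [sumMap3, idxRel]
  · rw [cross_layer _ _ _ _ _ _ _ _ (by omega) (by omega)]
    simp [sumMap3, idxRel]
  · simp only [and_comm (a := ctrVar (symmDiff A B) _ _ _ _ _)]
    rw [cross_layer _ _ _ _ _ _ _ _ (by omega) (by omega)]
    simp only [sumMap3, idxRel, Sum.exists, Sum.map_inl, Sum.map_inr]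
    simp
    rw [exists_comm]
    simp only [and_comm (a := clampIdx A.card _ _ = _)]
  · simp only [and_comm (a := ctrVar (symmDiff A B) _ _ _ _ _)]
    rw [cross_layer _ _ _ _ _ _ _ _ (by omega) (by omega)]
    simp only [sumMap3, idxRel, Sum.exists, Sum.map_inl, Sum.map_inr]
    simp
    rw [exists_comm]
    simp only [and_comm (a := clampIdx B.card _ _ = _)]
  · rw [same_layer _ _ _ _ (by omega) _ _ (by simpa using hij)]
    simp [sumMap3, idxRel]

/-- Merging the ends of a layer agrees with clamping indices. -/
theorem merge_layer {n : ℕ} (S : Finset (Fin n)) (σ : Equiv.Perm (Fin n)) (h : 4 ≤ S.card)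
    (p : Fin S.card) :
    mergeMap (layerPt S σ ⟨S.card - 2, by omega⟩) (layerPt S σ ⟨S.card - 1, by omega⟩)
      (mergeMap (layerPt S σ ⟨1, by omega⟩) (layerPt S σ ⟨0, by omega⟩) (layerPt S σ p)) =
    layerPt S σ (embIdx _ (clampIdx _ h p)) := by
  have hinj := (layerPt_bij S σ).1
  have hp := p.2
  unfold mergeMap
  by_cases h0 : p.1 = 0
  · rw [if_pos (congrArg _ (Fin.ext h0)), if_neg]
    · apply congrArg; apply Fin.ext; simp only [embIdx, clampIdx]; omega
    · intro he
      have := congrArg Fin.val (hinj he)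
      simp only at this
      omega
  · rw [if_neg (fun he => h0 (congrArg Fin.val (hinj he)))]
    by_cases h1 : p.1 = S.card - 1
    · rw [if_pos (congrArg _ (Fin.ext h1))]
      apply congrArg; apply Fin.ext; simp only [embIdx, clampIdx]; omega
    · rw [if_neg (fun he => h1 (congrArg Fin.val (hinj he)))]
      apply congrArg; apply Fin.ext; simp only [embIdx, clampIdx]; omega

theorem mergeMap_inl {α β : Type} [DecidableEq α] [DecidableEq β] (u v x : α) :
    mergeMap (Sum.inl u : α ⊕ β) (Sum.inl v) (Sum.inl x) = Sum.inl (mergeMap u v x) := by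
  unfold mergeMap
  simp only [Sum.inl.injEq]
  split_ifs <;> rfl

theorem mergeMap_inr {α β : Type} [DecidableEq α] [DecidableEq β] (u v x : β) :
    mergeMap (Sum.inr u : α ⊕ β) (Sum.inr v) (Sum.inr x) = Sum.inr (mergeMap u v x) := by
  unfold mergeMap
  simp only [Sum.inr.injEq]
  split_ifs <;> rfl

theorem mergeMap_inl_inr {α β : Type} [DecidableEq α] [DecidableEq β] (u v : α) (x : β) :
    mergeMap (Sum.inl u : α ⊕ β) (Sum.inl v) (Sum.inr x) = Sum.inr x := by
  unfold mergeMap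
  simp

theorem mergeMap_inr_inl {α β : Type} [DecidableEq α] [DecidableEq β] (u v : β) (x : α) :
    mergeMap (Sum.inr u : α ⊕ β) (Sum.inr v) (Sum.inl x) = Sum.inl x := by
  unfold mergeMap
  simp

theorem layer_survive {n : ℕ} (S : Finset (Fin n)) (σ : Equiv.Perm (Fin n)) (h : 4 ≤ S.card)
    (x : {i // i ∈ S}) :
    (x ≠ layerPt S σ ⟨0, by omega⟩ ∧ x ≠ layerPt S σ ⟨S.card - 1, by omega⟩) ↔
      ∃ j, layerPt S σ (embIdx _ j) = x := by
  obtain ⟨p, rfl⟩ := (layerPt_bij S σ).2 x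
  have hp := p.2
  simp only [(layerPt_bij S σ).1.eq_iff, ne_eq, embIdx, Fin.ext_iff]
  constructor
  · rintro ⟨h1, h2⟩
    exact ⟨⟨p.1 - 1, by omega⟩, by simp; omega⟩
  · rintro ⟨j, hj⟩
    have := j.2
    omega

end Aux

/-- For all `A, B ⊆ {x_1,…,x_n}` with `|A| ≥ 4`, `|B| ≥ 4`,
`|A △ B| ≥ 4` and all orderings `σa` of `A` and `σb` of `B`, the Tseitin graph of
`rAddPar(a, b)` is isomorphic to the graph obtained from `H` by contracting six edges —
the first and the last edge of each of the three layer paths of `H` (merging parallel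
edges, i.e. restricting to the vertices remaining after the merges); in particular its
treewidth is at least `tw(H) - 6`. -/
theorem rAddParTseitinGraph_iso_contraction (n : ℕ) (A B : Finset (Fin n))
    (hA : 4 ≤ A.card) (hB : 4 ≤ B.card) (hAB : 4 ≤ (symmDiff A B).card)
    (σa σb : Equiv.Perm (Fin n)) :
    (∃ (a1 a2 a3 a4 : {i // i ∈ A}) (b1 b2 b3 b4 : {i // i ∈ B})
        (c1 c2 c3 c4 : {i // i ∈ symmDiff A B}),
      (orderedElems A σa)[0]? = some a1.1 ∧
      (orderedElems A σa)[1]? = some a2.1 ∧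
      (orderedElems A σa)[(orderedElems A σa).length - 2]? = some a3.1 ∧
      (orderedElems A σa)[(orderedElems A σa).length - 1]? = some a4.1 ∧
      (orderedElems B σb)[0]? = some b1.1 ∧
      (orderedElems B σb)[1]? = some b2.1 ∧
      (orderedElems B σb)[(orderedElems B σb).length - 2]? = some b3.1 ∧
      (orderedElems B σb)[(orderedElems B σb).length - 1]? = some b4.1 ∧
      (orderedElems (symmDiff A B) (Equiv.refl (Fin n)))[0]? = some c1.1 ∧
      (orderedElems (symmDiff A B) (Equiv.refl (Fin n)))[1]? = some c2.1 ∧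
      (orderedElems (symmDiff A B) (Equiv.refl (Fin n)))[(orderedElems (symmDiff A B)
        (Equiv.refl (Fin n))).length - 2]? = some c3.1 ∧
      (orderedElems (symmDiff A B) (Equiv.refl (Fin n)))[(orderedElems (symmDiff A B)
        (Equiv.refl (Fin n))).length - 1]? = some c4.1 ∧
      Nonempty
        ((rAddParTseitinGraph n A B σa σb) ≃g
          ((contract
              (contract
                (contract
                  (contract
                    (contract
                      (contract (Hgraph n A B σa σb) (Sum.inl a2) (Sum.inl a1))
                      (Sum.inl a3) (Sum.inl a4))
                    (Sum.inr (Sum.inl b2)) (Sum.inr (Sum.inl b1)))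
                  (Sum.inr (Sum.inl b3)) (Sum.inr (Sum.inl b4)))
                (Sum.inr (Sum.inr c2)) (Sum.inr (Sum.inr c1)))
              (Sum.inr (Sum.inr c3)) (Sum.inr (Sum.inr c4))).induce
            {w | w ≠ Sum.inl a1 ∧ w ≠ Sum.inl a4 ∧
                 w ≠ Sum.inr (Sum.inl b1) ∧ w ≠ Sum.inr (Sum.inl b4) ∧
                 w ≠ Sum.inr (Sum.inr c1) ∧ w ≠ Sum.inr (Sum.inr c4)}))) ∧
    treewidth (Hgraph n A B σa σb) - 6 ≤ treewidth (rAddParTseitinGraph n A B σa σb) := by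
  classical
  set C := symmDiff A B with hCdef
  set σc := Equiv.refl (Fin n) with hσc
  let e : Fin (A.card - 2) ⊕ Fin (B.card - 2) ⊕ Fin (C.card - 2) →
      {i // i ∈ A} ⊕ {i // i ∈ B} ⊕ {i // i ∈ C} :=
    sumMap3 (fun j => layerPt A σa (embIdx _ j)) (fun j => layerPt B σb (embIdx _ j))
      (fun j => layerPt C σc (embIdx _ j))
  have he : Function.Injective e :=
    Sum.map_injective.2 ⟨(layerPt_bij A σa).1.comp (embIdx_inj _),
      Sum.map_injective.2 ⟨(layerPt_bij B σb).1.comp (embIdx_inj _),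
        (layerPt_bij C σc).1.comp (embIdx_inj _)⟩⟩
  let a1 := layerPt A σa ⟨0, by omega⟩
  let a2 := layerPt A σa ⟨1, by omega⟩
  let a3 := layerPt A σa ⟨A.card - 2, by omega⟩
  let a4 := layerPt A σa ⟨A.card - 1, by omega⟩
  let b1 := layerPt B σb ⟨0, by omega⟩
  let b2 := layerPt B σb ⟨1, by omega⟩
  let b3 := layerPt B σb ⟨B.card - 2, by omega⟩
  let b4 := layerPt B σb ⟨B.card - 1, by omega⟩
  let c1 := layerPt C σc ⟨0, by omega⟩
  let c2 := layerPt C σc ⟨1, by omega⟩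
  let c3 := layerPt C σc ⟨C.card - 2, by omega⟩
  let c4 := layerPt C σc ⟨C.card - 1, by omega⟩
  have hrange : ∀ w : {i // i ∈ A} ⊕ {i // i ∈ B} ⊕ {i // i ∈ C},
      (w ≠ Sum.inl a1 ∧ w ≠ Sum.inl a4 ∧
        w ≠ Sum.inr (Sum.inl b1) ∧ w ≠ Sum.inr (Sum.inl b4) ∧
        w ≠ Sum.inr (Sum.inr c1) ∧ w ≠ Sum.inr (Sum.inr c4)) ↔ ∃ j, e j = w := by
    have h1 := layer_survive A σa hA
    have h2 := layer_survive B σb hB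
    have h3 := layer_survive C σc hAB
    rintro (w | w | w)
    · simpa [e, sumMap3] using h1 w
    · simpa [e, sumMap3] using h2 w
    · simpa [e, sumMap3] using h3 w
  let pt : Fin A.card ⊕ Fin B.card ⊕ Fin C.card →
      {i // i ∈ A} ⊕ {i // i ∈ B} ⊕ {i // i ∈ C} :=
    sumMap3 (layerPt A σa) (layerPt B σb) (layerPt C σc)
  have hpt : Function.Surjective pt :=
    Sum.map_surjective.2 ⟨(layerPt_bij A σa).2,
      Sum.map_surjective.2 ⟨(layerPt_bij B σb).2, (layerPt_bij C σc).2⟩⟩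
  let F : {i // i ∈ A} ⊕ {i // i ∈ B} ⊕ {i // i ∈ C} →
      {i // i ∈ A} ⊕ {i // i ∈ B} ⊕ {i // i ∈ C} := fun x =>
    mergeMap (Sum.inr (Sum.inr c3)) (Sum.inr (Sum.inr c4))
      (mergeMap (Sum.inr (Sum.inr c2)) (Sum.inr (Sum.inr c1))
        (mergeMap (Sum.inr (Sum.inl b3)) (Sum.inr (Sum.inl b4))
          (mergeMap (Sum.inr (Sum.inl b2)) (Sum.inr (Sum.inl b1))
            (mergeMap (Sum.inl a3) (Sum.inl a4)
              (mergeMap (Sum.inl a2) (Sum.inl a1) x)))))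
  have hF : ∀ p, F (pt p) =
      e (sumMap3 (clampIdx _ hA) (clampIdx _ hB) (clampIdx _ hAB) p) := by
    rintro (p | p | p)
    · simp only [F, pt, e, sumMap3, Sum.map_inl, mergeMap_inl,
        mergeMap_inr_inl]
      exact congrArg _ (merge_layer A σa hA p)
    · simp only [F, pt, e, sumMap3, Sum.map_inl, Sum.map_inr, mergeMap_inl, mergeMap_inr,
        mergeMap_inr_inl, mergeMap_inl_inr]
      exact congrArg _ (congrArg _ (merge_layer B σb hB p))
    · simp only [F, pt, e, sumMap3, Sum.map_inr, mergeMap_inr,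
        mergeMap_inl_inr]
      exact congrArg _ (congrArg _ (merge_layer C σc hAB p))
  have hadj : ∀ i j, (imgGraph (Hgraph n A B σa σb) F).Adj (e i) (e j) ↔
      (rAddParTseitinGraph n A B σa σb).Adj i j := by
    intro i j
    rw [imgGraph_adj, tseitin_adj_idx n A B hA hB hAB, he.ne_iff]
    refine and_congr_right fun _ => ?_
    constructor
    · rintro ⟨x, y, h, h1, h2⟩
      obtain ⟨p, rfl⟩ := hpt x
      obtain ⟨q, rfl⟩ := hpt y
      rw [hF] at h1 h2
      exact ⟨p, q, (Hgraph_adj_idx n A B σa σb p q).1 h, he h1, he h2⟩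
    · rintro ⟨p, q, h, h1, h2⟩
      exact ⟨pt p, pt q, (Hgraph_adj_idx n A B σa σb p q).2 h,
        by rw [hF]; exact congrArg e h1, by rw [hF]; exact congrArg e h2⟩
  refine ⟨⟨a1, a2, a3, a4, b1, b2, b3, b4, c1, c2, c3, c4,
    layerPt_get _ _ _ _, layerPt_get _ _ _ _,
    by rw [length_orderedElems]; exact layerPt_get _ _ _ _,
    by rw [length_orderedElems]; exact layerPt_get _ _ _ _,
    layerPt_get _ _ _ _, layerPt_get _ _ _ _,
    by rw [length_orderedElems]; exact layerPt_get _ _ _ _,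
    by rw [length_orderedElems]; exact layerPt_get _ _ _ _,
    layerPt_get _ _ _ _, layerPt_get _ _ _ _,
    by rw [length_orderedElems]; exact layerPt_get _ _ _ _,
    by rw [length_orderedElems]; exact layerPt_get _ _ _ _, ?_⟩, ?_⟩
  · rw [contract_eq (Hgraph n A B σa σb)]
    simp only [contract_imgGraph]
    refine ⟨⟨Equiv.ofBijective (fun i => ⟨e i, (hrange (e i)).2 ⟨i, rfl⟩⟩)
      ⟨fun i j h => he (congrArg Subtype.val h), ?_⟩, ?_⟩⟩
    · rintro ⟨w, hw⟩
      obtain ⟨j, hj⟩ := (hrange w).1 hw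
      exact ⟨j, Subtype.ext hj⟩
    · intro i j
      exact hadj i j
  · let S : Finset ({i // i ∈ A} ⊕ {i // i ∈ B} ⊕ {i // i ∈ C}) :=
      {Sum.inl a1, Sum.inl a4, Sum.inr (Sum.inl b1), Sum.inr (Sum.inl b4),
        Sum.inr (Sum.inr c1), Sum.inr (Sum.inr c4)}
    have hS : ∀ w, w ∉ S ↔ ∃ j, e j = w := by
      intro w
      rw [← hrange]
      simp only [S, Finset.mem_insert, Finset.mem_singleton, not_or, ne_eq]
    have hScard : S.card ≤ 6 := Finset.card_le_six
    have hfix : ∀ i, F (e i) = e i := by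
      intro i
      have h1 : e i = pt (sumMap3 (embIdx _) (embIdx _) (embIdx _) i) := by
        rcases i with i | i | i <;> rfl
      rw [h1, hF]
      rcases i with i | i | i <;> simp [sumMap3, clampIdx_embIdx, e, pt]
    have := treewidth_le_add (Hgraph n A B σa σb) (rAddParTseitinGraph n A B σa σb) ⟨e, he⟩ S
      (fun v => by
        by_cases h : v ∈ S
        · exact Or.inl h
        · exact Or.inr ((hS v).1 h))
      (fun w => (hS _).2 ⟨w, rfl⟩)
      (fun u v h => (hadj u v).1 ((imgGraph_adj _ _ _ _).2
        ⟨h.ne, e u, e v, h, hfix u, hfix v⟩))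
    have h3 : treewidth (Hgraph n A B σa σb) ≤
        treewidth (rAddParTseitinGraph n A B σa σb) + S.card := by
      convert this
    omega
end

section
/- There is a constant α > 0 such that, when A and B are independent uniformly random subsets of X = {x_1,…,x_n} and σ_a and σ_b are independent uniformly random orderings of A and of B respectively, the probability that tw(H) < α·n tends to 0 as n → ∞. -/
variable {ν : Type} [DecidableEq ν]

theorem tree_nbr {ι : Type} (T : SimpleGraph ι) (hT : T.IsTree) (t : ι)
    (c : (T.induce ({t}ᶜ : Set ι)).ConnectedComponent) :
    ∃ s, T.Adj t s ∧ ∀ x (hx : x ∈ ({t}ᶜ : Set ι)),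
      (T.induce ({t}ᶜ : Set ι)).connectedComponentMk ⟨x, hx⟩ = c →
        T.dist s x + 1 ≤ T.dist t x := by
  classical
  induction c using SimpleGraph.ConnectedComponent.ind with
  | h x0 =>
  obtain ⟨x0, h0⟩ := x0
  obtain ⟨w⟩ := hT.connected.preconnected t x0
  obtain ⟨p, hp⟩ := w.toPath
  cases p with
  | nil => exact absurd rfl h0
  | @cons _ s _ hadj q =>
    rw [SimpleGraph.Walk.cons_isPath_iff] at hp
    refine ⟨s, hadj, ?_⟩
    intro x hx hc
    have hq : ∀ y ∈ q.support, y ∈ ({t}ᶜ : Set ι) := by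
      intro y hy hyt
      exact hp.2 (by rw [Set.mem_singleton_iff] at hyt; exact hyt ▸ hy)
    have hr : (T.induce ({t}ᶜ : Set ι)).Reachable ⟨s, hq s (by simp)⟩ ⟨x, hx⟩ :=
      SimpleGraph.Reachable.trans ⟨q.induce _ hq⟩
        (SimpleGraph.ConnectedComponent.exact hc).symm
    obtain ⟨r⟩ := hr
    let r' := r.map (SimpleGraph.Embedding.induce ({t}ᶜ : Set ι)).toHom
    have hr' : t ∉ r'.support := by
      intro h
      simp only [r', SimpleGraph.Walk.support_map, List.mem_map] at h
      obtain ⟨y, _, hy⟩ := h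
      exact y.2 hy
    have hr2 : t ∉ r'.bypass.support := fun h => hr' (r'.support_bypass_subset_support h)
    let P : T.Walk t x := SimpleGraph.Walk.cons hadj r'.bypass
    have hP : P.IsPath := by
      refine (SimpleGraph.Walk.cons_isPath_iff hadj r'.bypass).mpr ?_
      exact ⟨r'.bypass_isPath, hr2⟩
    obtain ⟨g, hg, hgl⟩ := hT.connected.exists_path_of_dist t x
    have := (hT.isAcyclic.subsingleton_path t x).elim ⟨g, hg⟩ ⟨P, hP⟩
    have hgP : g = P := congrArg Subtype.val this
    rw [← hgl, hgP]
    have hl : P.length = r'.bypass.length + 1 := SimpleGraph.Walk.length_cons hadj r'.bypass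
    have hdl : T.dist s x ≤ r'.bypass.length := SimpleGraph.dist_le r'.bypass
    omega

theorem sep_exists {V ι : Type} [Fintype V] [DecidableEq V] (G : SimpleGraph V)
    (T : SimpleGraph ι) (bag : ι → Finset V) (h : IsTreeDecomp G T bag) (k : ℕ)
    (hk : ∀ i, (bag i).card ≤ k) (W : Finset V) (hW : 2 * k ≤ W.card) :
    ∃ (S : Finset V) (χ : V → Bool), S.card ≤ k ∧
      (∀ u v, G.Adj u v → χ u ≠ χ v → u ∈ S ∨ v ∈ S) ∧
      W.card ≤ 4 * (W.filter (fun v => χ v = true)).card ∧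
      W.card ≤ 2 * (W.filter (fun v => χ v = false)).card := by
  classical
  obtain ⟨hT, hcov, hadj, hconn⟩ := h
  choose ρ hρ using hcov
  have : Nonempty ι := hT.connected.nonempty
  let Φ : ι → ℕ := fun t => ∑ v ∈ W, T.dist t (ρ v)
  obtain ⟨t, ht⟩ : ∃ t, ∀ s, Φ t ≤ Φ s := by
    obtain ⟨_, ⟨t, rfl⟩, h2⟩ := WellFounded.has_min (wellFounded_lt (α := ℕ)) (Set.range Φ)
      (Set.range_nonempty Φ)
    exact ⟨t, fun s => not_lt.mp (h2 _ ⟨s, rfl⟩)⟩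
  have hne : ∀ v i, v ∉ bag t → v ∈ bag i → i ∈ ({t}ᶜ : Set ι) := by
    intro v i hv hi hit
    rw [Set.mem_singleton_iff] at hit
    exact hv (hit ▸ hi)
  let f : V → Option (T.induce ({t}ᶜ : Set ι)).ConnectedComponent := fun v =>
    if hv : v ∈ bag t then none
    else some ((T.induce ({t}ᶜ : Set ι)).connectedComponentMk ⟨ρ v, hne v _ hv (hρ v)⟩)
  have hf0 : ∀ v, v ∈ bag t → f v = none := fun v hv => by simp only [f, dif_pos hv]
  have hf1 : ∀ v i (hv : v ∉ bag t) (hi : v ∈ bag i),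
      f v = some ((T.induce ({t}ᶜ : Set ι)).connectedComponentMk ⟨i, hne v _ hv hi⟩) := by
    intro v i hv hi
    simp only [f, dif_neg hv]
    congr 1
    apply SimpleGraph.ConnectedComponent.sound
    have hr := (hconn v).preconnected ⟨ρ v, hρ v⟩ ⟨i, hi⟩
    have hsub : {i | v ∈ bag i} ⊆ ({t}ᶜ : Set ι) := fun i hi => hne v i hv hi
    exact hr.map (SimpleGraph.induceHomOfLE T hsub).toHom
  have hf2 : ∀ u v, G.Adj u v → u ∉ bag t → v ∉ bag t → f u = f v := by
    intro u v huv hu hv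
    obtain ⟨i, h1, h2⟩ := hadj u v huv
    rw [hf1 u i hu h1, hf1 v i hv h2]
  have hhalf : ∀ c, 2 * (W.filter (fun v => f v = some c)).card ≤ W.card := by
    intro c
    obtain ⟨s, hs, hd⟩ := tree_nbr T hT t c
    have h1 := Finset.card_filter_add_card_filter_not (s := W) (fun v => f v = some c)
    have h2 : Φ s + (W.filter (fun v => f v = some c)).card ≤
        Φ t + (W.filter (fun v => ¬ f v = some c)).card := by
      simp only [Φ, Finset.card_filter, ← Finset.sum_add_distrib]
      apply Finset.sum_le_sum
      intro v _
      by_cases hv : f v = some c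
      · simp only [hv, if_true, not_true_eq_false, if_false, add_zero]
        by_cases hb : v ∈ bag t
        · rw [hf0 v hb] at hv; simp at hv
        · rw [hf1 v _ hb (hρ v)] at hv
          exact hd _ (hne v _ hb (hρ v)) (Option.some.inj hv)
      · simp only [hv, if_false, not_false_eq_true, if_true, add_zero]
        have := hT.connected.dist_triangle (u := s) (v := t) (w := ρ v)
        have h3 : T.dist s t = 1 := by rw [SimpleGraph.dist_eq_one_iff_adj]; exact hs.symm
        omega
    have := ht s
    omega
  let wt : Finset (Option (T.induce ({t}ᶜ : Set ι)).ConnectedComponent) → ℕ :=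
    fun Z => (W.filter (fun v => f v ∈ Z)).card
  have hex : ∃ m : ℕ, ∃ Z : Finset (Option (T.induce ({t}ᶜ : Set ι)).ConnectedComponent),
      Z.card = m ∧ none ∉ Z ∧ W.card ≤ 4 * wt Z := by
    refine ⟨_, (W.image f).erase none, rfl, by simp, ?_⟩
    have h1 := Finset.card_filter_add_card_filter_not (s := W)
      (fun v => f v ∈ (W.image f).erase none)
    have h2 : (W.filter (fun v => ¬ f v ∈ (W.image f).erase none)).card ≤ k := by
      refine le_trans (Finset.card_le_card ?_) (hk t)
      intro v hv
      rw [Finset.mem_filter] at hv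
      by_contra hb
      apply hv.2
      rw [Finset.mem_erase]
      refine ⟨?_, Finset.mem_image_of_mem f hv.1⟩
      rw [hf1 v _ hb (hρ v)]; simp
    simp only [wt]
    omega
  obtain ⟨Z, hZc, hZn, hZw⟩ := Nat.find_spec hex
  have hmin : ∀ Z', Z'.card < Z.card → none ∉ Z' → 4 * wt Z' < W.card := by
    intro Z' h1 h2
    rw [hZc] at h1
    have := Nat.find_min hex h1
    by_contra h3
    exact this ⟨Z', rfl, h2, by omega⟩
  have hZ2 : 2 * wt Z ≤ W.card := by
    by_cases hZe : Z = ∅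
    · simp [wt, hZe]
    · obtain ⟨c, hc⟩ := Finset.nonempty_iff_ne_empty.mpr hZe
      have hs1 : wt {c} * 2 ≤ W.card := by
        cases c with
        | none => exact absurd hc hZn
        | some c => simpa [wt, mul_comm] using hhalf c
      have hsum : wt Z ≤ wt {c} + wt (Z.erase c) := by
        simp only [wt]
        refine le_trans (Finset.card_le_card ?_) (Finset.card_union_le _ _)
        intro v hv
        simp only [Finset.mem_union, Finset.mem_filter, Finset.mem_singleton,
          Finset.mem_erase] at hv ⊢
        tauto
      have hpos : 1 ≤ Z.card := Finset.card_pos.mpr ⟨c, hc⟩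
      have hce := Finset.card_erase_of_mem hc
      by_cases h1 : Z.card = 1
      · have : Z.erase c = ∅ := by rw [← Finset.card_eq_zero]; omega
        have h0 : wt (Z.erase c) = 0 := by simp [this, wt]
        omega
      · have ha := hmin {c} (by rw [Finset.card_singleton]; omega)
          (by rw [Finset.mem_singleton]; rintro rfl; exact hZn hc)
        have hb := hmin (Z.erase c) (by omega) (fun h => hZn (Finset.mem_of_mem_erase h))
        omega
  refine ⟨bag t, fun v => decide (f v ∈ Z), hk t, ?_, ?_, ?_⟩
  · intro u v huv hne'
    by_contra hcon
    push Not at hcon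
    exact hne' (by simp only [hf2 u v huv hcon.1 hcon.2])
  · simpa [wt] using hZw
  · have h1 := Finset.card_filter_add_card_filter_not (s := W) (fun v => f v ∈ Z)
    simp only [wt] at hZ2
    simp only [decide_eq_false_iff_not]
    omega

theorem treewidth_spec {V : Type} [Fintype V] [DecidableEq V] (G : SimpleGraph V) :
    ∃ (ι : Type) (T : SimpleGraph ι) (bag : ι → Finset V),
      IsTreeDecomp G T bag ∧ ∀ i, (bag i).card ≤ treewidth G + 1 := by
  have hne : {w | ∃ (ι : Type) (T : SimpleGraph ι) (bag : ι → Finset V),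
    IsTreeDecomp G T bag ∧ ∀ i, (bag i).card ≤ w + 1}.Nonempty := by
    refine ⟨Fintype.card V, Unit, ⊥, fun _ => Finset.univ, ⟨?_, ?_, ?_, ?_⟩, ?_⟩
    · exact SimpleGraph.IsTree.of_subsingleton
    · intro v; exact ⟨(), by simp⟩
    · intro u v _; exact ⟨(), by simp⟩
    · intro v
      have : Nonempty ↑{i : Unit | v ∈ (Finset.univ : Finset V)} := ⟨⟨(), by simp⟩⟩
      exact (SimpleGraph.IsTree.of_subsingleton).connected
    · intro i; rw [Finset.card_univ]; omega
  exact Nat.sInf_mem hne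

/-- Permutations whose inverse maps `P` into a small set are rare. -/
theorem perm_count {n : ℕ} (R : Finset (Fin n)) (hR : 2 * R.card ≤ n) (P : Finset (Fin n)) :
    2 ^ P.card * ((Finset.univ : Finset (Equiv.Perm (Fin n))).filter
      (fun σ => ∀ v ∈ P, σ.symm v ∈ R)).card ≤ n.factorial := by
  classical
  induction P using Finset.induction_on with
  | empty => simp [Fintype.card_perm]
  | insert v P hv ih =>
    set N := (Finset.univ : Finset (Equiv.Perm (Fin n))).filter
      (fun σ => ∀ v ∈ P, σ.symm v ∈ R) with hN
    have hins : (Finset.univ : Finset (Equiv.Perm (Fin n))).filter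
      (fun σ => ∀ w ∈ insert v P, σ.symm w ∈ R) = N.filter (fun σ => σ.symm v ∈ R) := by
      ext σ
      simp [hN, and_comm]
    rw [hins]
    have hsym : ∀ w ∈ Pᶜ, (N.filter (fun σ => σ.symm w ∈ R)).card =
        (N.filter (fun σ => σ.symm v ∈ R)).card := by
      intro w hw
      rw [Finset.mem_compl] at hw
      apply Finset.card_equiv (Equiv.mulLeft (Equiv.swap v w))
      intro σ
      have key : ∀ u, (Equiv.swap v w * σ).symm u = σ.symm (Equiv.swap v w u) := by
        intro u
        rw [Equiv.symm_apply_eq]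
        simp
      simp only [hN, Finset.mem_filter, Finset.mem_univ, true_and, Equiv.coe_mulLeft, key,
        Equiv.swap_apply_left]
      have : ∀ u ∈ P, Equiv.swap v w u = u := by
        intro u hu
        apply Equiv.swap_apply_of_ne_of_ne
        · rintro rfl; exact hv hu
        · rintro rfl; exact hw hu
      constructor
      · rintro ⟨h1, h2⟩
        exact ⟨fun u hu => by rw [this u hu]; exact h1 u hu, h2⟩
      · rintro ⟨h1, h2⟩
        exact ⟨fun u hu => by have := this u hu; rw [← this]; exact h1 u hu, h2⟩
    have hdc : ∑ w ∈ Pᶜ, (N.filter (fun σ => σ.symm w ∈ R)).card =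
        ∑ σ ∈ N, (Pᶜ.filter (fun w => σ.symm w ∈ R)).card := by
      simp only [Finset.card_filter]
      exact Finset.sum_comm
    rw [Finset.sum_congr rfl hsym, Finset.sum_const, smul_eq_mul] at hdc
    have hbd : ∀ σ ∈ N, (Pᶜ.filter (fun w => σ.symm w ∈ R)).card + P.card ≤ R.card := by
      intro σ hσ
      rw [hN, Finset.mem_filter] at hσ
      rw [← Finset.card_union_of_disjoint]
      · rw [← Finset.card_image_of_injective _ σ.symm.injective]
        apply Finset.card_le_card
        intro x hx
        simp only [Finset.mem_image, Finset.mem_union, Finset.mem_filter] at hx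
        obtain ⟨w, hw | hw, rfl⟩ := hx
        · exact hw.2
        · exact hσ.2 w hw
      · rw [Finset.disjoint_left]
        intro x hx hx2
        rw [Finset.mem_filter, Finset.mem_compl] at hx
        exact hx.1 hx2
    have hPc : Pᶜ.card + P.card = n := by
      rw [add_comm, Finset.card_add_card_compl, Fintype.card_fin]
    have hPpos : 0 < Pᶜ.card := Finset.card_pos.mpr ⟨v, by simpa using hv⟩
    have hsum : 2 * ∑ σ ∈ N, (Pᶜ.filter (fun w => σ.symm w ∈ R)).card ≤ N.card * Pᶜ.card := by
      rw [Finset.mul_sum]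
      calc _ ≤ ∑ σ ∈ N, Pᶜ.card := by
            apply Finset.sum_le_sum
            intro σ hσ
            have := hbd σ hσ
            omega
        _ = _ := by simp
    rw [← hdc] at hsum
    have h2 : 2 * (N.filter (fun σ => σ.symm v ∈ R)).card ≤ N.card := by
      have : Pᶜ.card * (2 * (N.filter (fun σ => σ.symm v ∈ R)).card) ≤ Pᶜ.card * N.card := by
        linarith [hsum, mul_comm N.card Pᶜ.card]
      exact Nat.le_of_mul_le_mul_left this hPpos
    rw [Finset.card_insert_of_notMem hv, pow_succ, mul_assoc]
    exact le_trans (Nat.mul_le_mul_left _ h2) ih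

/-- The subsets of `Fin n` with at most `k` elements. -/
def smallSets (n k : ℕ) : Finset (Finset (Fin n)) := Finset.univ.filter (fun D => D.card ≤ k)

theorem smallSets_bound (ε : ℝ) (hε : 0 < ε) :
    ∃ q : ℕ, 0 < q ∧ ∀ n k : ℕ, q * k ≤ n → ((smallSets n k).card : ℝ) ≤ (1 + ε) ^ n := by
  obtain ⟨x, hx0, hx1, hx2⟩ : ∃ x : ℝ, 0 < x ∧ x ≤ 1 ∧ (1 + x) ^ 2 ≤ 1 + ε := by
    refine ⟨min 1 (ε / 3), by positivity, min_le_left _ _, ?_⟩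
    have h1 := min_le_left 1 (ε / 3)
    have h2 := min_le_right 1 (ε / 3)
    have h3 : 0 < min 1 (ε / 3) := by positivity
    nlinarith
  obtain ⟨q, hq⟩ := pow_unbounded_of_one_lt (1 / x) (show 1 < 1 + x by linarith)
  refine ⟨q + 1, by omega, ?_⟩
  intro n k hk
  have h1 : ((smallSets n k).card : ℝ) * x ^ k ≤ (1 + x) ^ n := by
    have := Finset.sum_pow_mul_eq_add_pow x 1 (Finset.univ : Finset (Fin n))
    simp only [one_pow, mul_one, Finset.card_univ, Fintype.card_fin] at this
    rw [add_comm, ← this, Finset.powerset_univ]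
    calc ((smallSets n k).card : ℝ) * x ^ k = ∑ D ∈ smallSets n k, x ^ k := by simp
      _ ≤ ∑ D ∈ smallSets n k, x ^ D.card := by
          apply Finset.sum_le_sum
          intro D hD
          simp only [smallSets, Finset.mem_filter] at hD
          exact pow_le_pow_of_le_one hx0.le hx1 hD.2
      _ ≤ _ := by
          apply Finset.sum_le_sum_of_subset_of_nonneg (Finset.subset_univ _)
          intros; positivity
  have h2 : 1 ≤ x ^ k * (1 + x) ^ n := by
    have h3 : 1 ≤ x * (1 + x) ^ (q + 1) := by
      rw [div_lt_iff₀ hx0] at hq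
      have : (1 + x) ^ q ≤ (1 + x) ^ (q + 1) := pow_le_pow_right₀ (by linarith) (by omega)
      nlinarith
    calc (1 : ℝ) ≤ (x * (1 + x) ^ (q + 1)) ^ k := one_le_pow₀ h3
      _ = x ^ k * (1 + x) ^ ((q + 1) * k) := by rw [mul_pow, pow_mul]
      _ ≤ x ^ k * (1 + x) ^ n := by
        gcongr
        linarith
  calc ((smallSets n k).card : ℝ) ≤ (smallSets n k).card * (x ^ k * (1 + x) ^ n) := by
        exact le_mul_of_one_le_right (by positivity) h2
    _ = ((smallSets n k).card * x ^ k) * (1 + x) ^ n := by ring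
    _ ≤ (1 + x) ^ n * (1 + x) ^ n := by gcongr
    _ = ((1 + x) ^ 2) ^ n := by rw [← pow_mul, ← pow_add]; congr 1; ring
    _ ≤ _ := by gcongr

/-- Few pairs of sets have a small intersection. -/
theorem small_inter (n k : ℕ) :
    ((Finset.univ : Finset (Finset (Fin n) × Finset (Fin n))).filter
      (fun p => (p.1 ∩ p.2).card ≤ k)).card ≤ (smallSets n k).card * 3 ^ n := by
  classical
  have : (smallSets n k).card * 3 ^ n =
      (smallSets n k ×ˢ (Finset.univ : Finset (Fin n → Fin 3))).card := by
    simp [Finset.card_product]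
  rw [this]
  apply Finset.card_le_card_of_injOn
    (fun p => (p.1 ∩ p.2, fun i => if i ∈ p.1 then 1 else if i ∈ p.2 then 2 else 0))
  · intro p hp
    simpa [smallSets] using hp
  · rintro ⟨A, B⟩ _ ⟨A', B'⟩ _ h
    simp only [Prod.mk.injEq] at h
    obtain ⟨h1, h2⟩ := h
    have hp : ∀ i, (i ∈ A ↔ i ∈ A') ∧ (i ∈ B ↔ i ∈ B') := by
      intro i
      have h2 := congrFun h2 i
      have h1 : i ∈ A ∩ B ↔ i ∈ A' ∩ B' := by rw [h1]
      simp only [Finset.mem_inter] at h1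
      by_cases a : i ∈ A <;> by_cases b : i ∈ B <;> by_cases a' : i ∈ A' <;>
        by_cases b' : i ∈ B' <;> simp_all
    rw [Prod.mk.injEq]
    exact ⟨Finset.ext fun i => (hp i).1, Finset.ext fun i => (hp i).2⟩

theorem consec_filter {α : Type} (p : α → Bool) (l : List α) (i j : ℕ) (hji : j < i)
    (hi : i < l.length) (hpj : p (l[j]) = true) (hpi : p (l[i]) = true)
    (hb : ∀ m (hm : m < l.length), j < m → m < i → p (l[m]) = false) :
    consec (l.filter p) l[j] l[i] := by
  have e1 : l = l.take j ++ l[j] :: ((l.drop (j + 1)).take (i - j - 1) ++ l[i] :: l.drop (i + 1)) := by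
    have a1 : l[i] :: l.drop (i + 1) = (l.drop (j + 1)).drop (i - j - 1) := by
      rw [List.getElem_cons_drop, List.drop_drop]
      congr 1
      omega
    rw [a1, List.take_append_drop, List.getElem_cons_drop, List.take_append_drop]
  have e2 : ((l.drop (j + 1)).take (i - j - 1)).filter p = [] := by
    rw [List.filter_eq_nil_iff]
    intro a ha
    rw [List.mem_iff_getElem] at ha
    obtain ⟨m, hm, rfl⟩ := ha
    simp only [List.length_take, List.length_drop] at hm
    simp only [List.getElem_take, List.getElem_drop]
    rw [hb _ (by omega) (by omega) (by omega)]
    simp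
  have e3 : l.filter p = (l.take j).filter p ++ l[j] :: l[i] :: (l.drop (i + 1)).filter p := by
    conv_lhs => rw [e1]
    rw [List.filter_append, List.filter_cons_of_pos hpj, List.filter_append, e2,
      List.filter_cons_of_pos hpi]
    rfl
  rw [e3]
  exact ⟨((l.take j).filter p).length, by simp, by simp⟩

theorem consec_ordered {n : ℕ} (A : Finset (Fin n)) (σ : Equiv.Perm (Fin n)) (i j : Fin n)
    (hji : j < i) (hj : σ j ∈ A) (hi : σ i ∈ A) (hb : ∀ m, j < m → m < i → σ m ∉ A) :
    consec (orderedElems A σ) (σ j) (σ i) := by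
  have := consec_filter (fun i => decide (i ∈ A)) (List.ofFn (fun i => σ i)) i j hji (by simp)
    (by simpa using hj) (by simpa using hi) (by
      intro m hm h1 h2
      simp only [List.getElem_ofFn, decide_eq_false_iff_not]
      exact hb _ h1 h2)
  simpa [orderedElems] using this

/-- The colouring of positions whose set of colour changes is `D`. -/
def dec {n : ℕ} (D : Finset (Fin n)) (i : Fin n) : Bool :=
  decide ((D.filter (fun d => d ≤ i)).card % 2 = 1)

/-- The colour carried along the positions. -/
def carry {n : ℕ} (A : Finset (Fin n)) (σ : Equiv.Perm (Fin n)) (χ : Fin n → Bool) : ℕ → Bool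
  | 0 => false
  | i + 1 => if h : i < n then
      (if σ ⟨i, h⟩ ∈ A then χ (σ ⟨i, h⟩) else carry A σ χ i) else carry A σ χ i

theorem exists_dec {n : ℕ} (A : Finset (Fin n)) (σ : Equiv.Perm (Fin n)) (χ : Fin n → Bool)
    (S : Finset (Fin n))
    (hS : ∀ u ∈ A, ∀ v ∈ A, consec (orderedElems A σ) u v → χ u ≠ χ v → u ∈ S ∨ v ∈ S) :
    ∃ D : Finset (Fin n), D.card ≤ 2 * S.card + 1 ∧ ∀ v ∈ A, dec D (σ.symm v) = χ v := by
  classical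
  let q := carry A σ χ
  have hq1 : ∀ i : Fin n, σ i ∈ A → q (i + 1) = χ (σ i) := by
    intro i hi
    simp [q, carry, hi]
  have hq2 : ∀ i : Fin n, σ i ∉ A → q (i + 1) = q i := by
    intro i hi
    simp [q, carry, hi]
  have hq : ∀ i : ℕ, i ≤ n → (∀ m : Fin n, (m : ℕ) < i → σ m ∉ A) ∨
      ∃ j : Fin n, (j : ℕ) < i ∧ σ j ∈ A ∧ (∀ m : Fin n, j < m → (m : ℕ) < i → σ m ∉ A) ∧
        q i = χ (σ j) := by
    intro i
    induction i with
    | zero => intro _; left; intro m hm; omega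
    | succ i ih =>
      intro hi
      by_cases hA : σ ⟨i, hi⟩ ∈ A
      · right
        refine ⟨⟨i, hi⟩, by simp, hA, ?_, hq1 ⟨i, hi⟩ hA⟩
        intro m h1 h2
        rw [Fin.lt_def] at h1
        simp at h1
        omega
      · have hmi : ∀ m : Fin n, (m : ℕ) < i + 1 → (m : ℕ) < i ∨ m = ⟨i, hi⟩ := by
          intro m hm
          rw [Fin.ext_iff]
          simp only
          omega
        rcases ih (by omega) with h | ⟨j, h1, h2, h3, h4⟩
        · left
          intro m hm
          rcases hmi m hm with h' | rfl
          · exact h m h'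
          · exact hA
        · right
          refine ⟨j, by omega, h2, ?_, ?_⟩
          · intro m hm hm2
            rcases hmi m hm2 with h' | rfl
            · exact h3 m hm h'
            · exact hA
          · rw [← h4]; exact hq2 ⟨i, hi⟩ hA
  let D : Finset (Fin n) := Finset.univ.filter (fun i => q (i + 1) ≠ q i)
  refine ⟨D, ?_, ?_⟩
  · let D1 : Finset (Fin n) := Finset.univ.filter (fun i => σ i ∈ S)
    let D2 : Finset (Fin n) := Finset.univ.filter (fun i => σ i ∈ A ∧ ∃ j, j < i ∧ σ j ∈ A ∧
      σ j ∈ S ∧ ∀ m, j < m → m < i → σ m ∉ A)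
    let D3 : Finset (Fin n) := Finset.univ.filter (fun i => σ i ∈ A ∧ ∀ m, m < i → σ m ∉ A)
    have hsub : D ⊆ D1 ∪ D2 ∪ D3 := by
      intro i hi
      simp only [D, Finset.mem_filter, Finset.mem_univ, true_and] at hi
      have hA : σ i ∈ A := by
        by_contra h
        exact hi (hq2 i h)
      simp only [D1, D2, D3, Finset.mem_union, Finset.mem_filter, Finset.mem_univ, true_and]
      rcases hq i i.2.le with h | ⟨j, h1, h2, h3, h4⟩
      · right; exact ⟨hA, h⟩
      · left
        rw [hq1 i hA, h4] at hi
        rcases hS _ h2 _ hA (consec_ordered A σ i j h1 h2 hA h3) (Ne.symm hi) with h | h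
        · right; exact ⟨hA, j, h1, h2, h, h3⟩
        · left; exact h
    have c1 : D1.card ≤ S.card := by
      apply Finset.card_le_card_of_injOn σ
      · intro i hi; simpa [D1] using hi
      · exact σ.injective.injOn
    have c2 : D2.card ≤ S.card := by
      apply Finset.card_le_card_of_forall_subsingleton
        (fun i u => σ i ∈ A ∧ ∃ j, σ j = u ∧ j < i ∧ σ j ∈ A ∧ ∀ m, j < m → m < i → σ m ∉ A)
      · intro i hi
        simp only [D2, Finset.mem_filter, Finset.mem_univ, true_and] at hi
        obtain ⟨hA, j, h1, h2, h3, h4⟩ := hi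
        exact ⟨σ j, h3, hA, j, rfl, h1, h2, h4⟩
      · rintro u _ i ⟨_, hA, j, rfl, h1, h2, h3⟩ i' ⟨_, hA', j', h0, h1', h2', h3'⟩
        have := σ.injective h0
        subst this
        rcases lt_trichotomy i i' with h | h | h
        · exact absurd hA (h3' i h1 h)
        · exact h
        · exact absurd hA' (h3 i' h1' h)
    have c3 : D3.card ≤ 1 := by
      rw [Finset.card_le_one]
      intro a ha b hb
      simp only [D3, Finset.mem_filter, Finset.mem_univ, true_and] at ha hb
      rcases lt_trichotomy a b with h | h | h
      · exact absurd ha.1 (hb.2 a h)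
      · exact h
      · exact absurd hb.1 (ha.2 b h)
    have := Finset.card_le_card hsub
    have := Finset.card_union_le (D1 ∪ D2) D3
    have := Finset.card_union_le D1 D2
    omega
  · have hdec : ∀ i : ℕ, i ≤ n →
        decide ((D.filter (fun d : Fin n => (d : ℕ) < i)).card % 2 = 1) = q i := by
      intro i
      induction i with
      | zero => intro _; simp [q, carry]
      | succ i ih =>
        intro hi
        have ih := ih (by omega)
        by_cases hd : (⟨i, hi⟩ : Fin n) ∈ D
        · have : D.filter (fun d : Fin n => (d : ℕ) < i + 1) =
              insert ⟨i, hi⟩ (D.filter (fun d : Fin n => (d : ℕ) < i)) := by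
            ext m
            simp only [Finset.mem_filter, Finset.mem_insert]
            constructor
            · rintro ⟨h1, h2⟩
              by_cases h : (m : ℕ) = i
              · left; exact Fin.ext h
              · right; exact ⟨h1, by omega⟩
            · rintro (rfl | ⟨h1, h2⟩)
              · exact ⟨hd, by simp⟩
              · exact ⟨h1, by omega⟩
          rw [this, Finset.card_insert_of_notMem (by simp)]
          simp only [D, Finset.mem_filter, Finset.mem_univ, true_and] at hd
          change q (i + 1) ≠ q i at hd
          rw [← ih] at hd
          revert hd
          cases hqi : q (i + 1) <;> simp <;> omega
        · have : D.filter (fun d : Fin n => (d : ℕ) < i + 1) = D.filter (fun d : Fin n => (d : ℕ) < i) := by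
            ext m
            simp only [Finset.mem_filter]
            constructor
            · rintro ⟨h1, h2⟩
              refine ⟨h1, ?_⟩
              by_contra h
              apply hd
              have : m = ⟨i, hi⟩ := Fin.ext (by simp only; omega)
              rw [← this]; exact h1
            · rintro ⟨h1, h2⟩
              exact ⟨h1, by omega⟩
          rw [this, ih]
          simp only [D, Finset.mem_filter, Finset.mem_univ, true_and, not_not] at hd
          exact hd.symm
    intro v hv
    have h1 := hq1 (σ.symm v) (by simpa using hv)
    rw [Equiv.apply_symm_apply] at h1
    rw [← h1, ← hdec _ (σ.symm v).2]
    simp only [dec, Fin.le_def, Nat.lt_succ_iff]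

theorem H_struct {n : ℕ} (A B : Finset (Fin n)) (σa σb : Equiv.Perm (Fin n)) (s : ℕ)
    (hs : treewidth (Hgraph n A B σa σb) + 1 ≤ s) (hm : 2 * s ≤ (A ∩ B).card) :
    ∃ D1 D2 E : Finset (Fin n), D1.card ≤ 2 * s + 1 ∧ D2.card ≤ 2 * s + 1 ∧ E.card ≤ s ∧
      (∀ v ∈ A ∩ B, v ∉ E → dec D1 (σa.symm v) = dec D2 (σb.symm v)) ∧
      (A ∩ B).card ≤ 4 * ((A ∩ B).filter (fun v => dec D1 (σa.symm v) = true)).card ∧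
      (A ∩ B).card ≤ 2 * ((A ∩ B).filter (fun v => dec D1 (σa.symm v) = false)).card := by
  classical
  obtain ⟨ι, T, bag, hdec, hbag⟩ := treewidth_spec (Hgraph n A B σa σb)
  let W : Finset ({i // i ∈ A} ⊕ {i // i ∈ B} ⊕ {i // i ∈ symmDiff A B}) :=
    (A ∩ B).attach.image (fun v => Sum.inl ⟨v.1, (Finset.mem_inter.mp v.2).1⟩)
  have hWc : W.card = (A ∩ B).card := by
    rw [Finset.card_image_of_injective, Finset.card_attach]
    intro u v h
    simp only [Sum.inl.injEq, Subtype.mk.injEq] at h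
    exact Subtype.ext h
  obtain ⟨S, χ, hS, hχ, hW1, hW2⟩ := sep_exists (Hgraph n A B σa σb) T bag hdec s
    (fun i => (hbag i).trans hs) W (by omega)
  let vl : ({i // i ∈ A} ⊕ {i // i ∈ B} ⊕ {i // i ∈ symmDiff A B}) → Fin n :=
    Sum.elim (fun i => i.1) (Sum.elim (fun i => i.1) (fun i => i.1))
  let S' := S.image vl
  have hS' : S'.card ≤ s := Finset.card_image_le.trans hS
  let χa : Fin n → Bool := fun v => if h : v ∈ A then χ (Sum.inl ⟨v, h⟩) else false
  let χb : Fin n → Bool := fun v => if h : v ∈ B then χ (Sum.inr (Sum.inl ⟨v, h⟩)) else false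
  have ha : ∀ v (h : v ∈ A), χa v = χ (Sum.inl ⟨v, h⟩) := fun v h => by simp only [χa, dif_pos h]
  have hb : ∀ v (h : v ∈ B), χb v = χ (Sum.inr (Sum.inl ⟨v, h⟩)) := fun v h => by
    simp only [χb, dif_pos h]
  have hmem : ∀ x, x ∈ S → vl x ∈ S' := fun x hx => Finset.mem_image_of_mem vl hx
  obtain ⟨D1, hD1, hd1⟩ := exists_dec A σa χa S' (by
    intro u hu v hv hc hne
    rw [ha u hu, ha v hv] at hne
    have hadj : (Hgraph n A B σa σb).Adj (Sum.inl ⟨u, hu⟩) (Sum.inl ⟨v, hv⟩) := by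
      rw [Hgraph, SimpleGraph.fromRel_adj]
      exact ⟨fun h => hne (by rw [h]), Or.inl hc⟩
    exact (hχ _ _ hadj hne).imp (hmem _) (hmem _))
  obtain ⟨D2, hD2, hd2⟩ := exists_dec B σb χb S' (by
    intro u hu v hv hc hne
    rw [hb u hu, hb v hv] at hne
    have hadj : (Hgraph n A B σa σb).Adj (Sum.inr (Sum.inl ⟨u, hu⟩))
        (Sum.inr (Sum.inl ⟨v, hv⟩)) := by
      rw [Hgraph, SimpleGraph.fromRel_adj]
      exact ⟨fun h => hne (by rw [h]), Or.inl hc⟩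
    exact (hχ _ _ hadj hne).imp (hmem _) (hmem _))
  have hcard : ∀ b : Bool, (W.filter (fun x => χ x = b)).card ≤
      ((A ∩ B).filter (fun v => dec D1 (σa.symm v) = b)).card := by
    intro b
    apply Finset.card_le_card_of_injOn vl
    · intro x hx
      simp only [W, Finset.coe_filter, Finset.mem_image, Finset.mem_attach, true_and,
        Set.mem_ofPred_eq] at hx
      obtain ⟨⟨v, rfl⟩, hx⟩ := hx
      have hvA := (Finset.mem_inter.mp v.2).1
      simp only [Finset.coe_filter, Set.mem_ofPred_eq]
      refine ⟨v.2, ?_⟩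
      change dec D1 (σa.symm v.1) = b
      rw [hd1 v.1 hvA, ha v.1 hvA, hx]
    · intro x hx y hy hxy
      simp only [W, Finset.coe_filter, Finset.mem_image, Finset.mem_attach, true_and,
        Set.mem_ofPred_eq] at hx hy
      obtain ⟨⟨v, rfl⟩, hx⟩ := hx
      obtain ⟨⟨u, rfl⟩, hy⟩ := hy
      have : v.1 = u.1 := hxy
      simp [this]
  refine ⟨D1, D2, S', by omega, by omega, hS', ?_, ?_, ?_⟩
  · intro v hv hvS
    obtain ⟨hvA, hvB⟩ := Finset.mem_inter.mp hv
    rw [hd1 v hvA, hd2 v hvB, ha v hvA, hb v hvB]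
    by_contra hne
    have hadj : (Hgraph n A B σa σb).Adj (Sum.inl ⟨v, hvA⟩) (Sum.inr (Sum.inl ⟨v, hvB⟩)) := by
      rw [Hgraph, SimpleGraph.fromRel_adj]
      exact ⟨by simp, Or.inl rfl⟩
    rcases hχ _ _ hadj hne with h | h
    · exact hvS (hmem _ h)
    · exact hvS (hmem _ h)
  · have := hcard true
    omega
  · have := hcard false
    omega

theorem count_b {n : ℕ} (A B : Finset (Fin n)) (σa : Equiv.Perm (Fin n)) (s j : ℕ)
    (hj : 4 * (j + s) ≤ (A ∩ B).card) :
    2 ^ j * ((Finset.univ : Finset (Equiv.Perm (Fin n))).filter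
      (fun σb => treewidth (Hgraph n A B σa σb) + 1 ≤ s)).card ≤
      (smallSets n (3 * s)).card ^ 3 * n.factorial := by
  classical
  let F : Finset (Fin n) × Finset (Fin n) × Finset (Fin n) → Finset (Equiv.Perm (Fin n)) :=
    fun t => Finset.univ.filter (fun σb => t.2.2.card ≤ s ∧
      (∀ v ∈ A ∩ B, v ∉ t.2.2 → dec t.1 (σa.symm v) = dec t.2.1 (σb.symm v)) ∧
      (A ∩ B).card ≤ 4 * ((A ∩ B).filter (fun v => dec t.1 (σa.symm v) = true)).card ∧
      (A ∩ B).card ≤ 2 * ((A ∩ B).filter (fun v => dec t.1 (σa.symm v) = false)).card)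
  let I := smallSets n (3 * s) ×ˢ smallSets n (3 * s) ×ˢ smallSets n (3 * s)
  have hsub : (Finset.univ : Finset (Equiv.Perm (Fin n))).filter
      (fun σb => treewidth (Hgraph n A B σa σb) + 1 ≤ s) ⊆ I.biUnion F := by
    intro σb hσ
    rw [Finset.mem_filter] at hσ
    obtain ⟨D1, D2, E, h1, h2, h3, h4⟩ := H_struct A B σa σb s hσ.2 (by omega)
    rw [Finset.mem_biUnion]
    refine ⟨(D1, D2, E), ?_, ?_⟩
    · simp only [I, smallSets, Finset.mem_product, Finset.mem_filter, Finset.mem_univ, true_and]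
      omega
    · simp only [F, Finset.mem_filter, Finset.mem_univ, true_and]
      exact ⟨h3, h4⟩
  have hF : ∀ t, 2 ^ j * (F t).card ≤ n.factorial := by
    rintro ⟨D1, D2, E⟩
    by_cases hne : (F (D1, D2, E)).Nonempty
    · obtain ⟨σ0, h0⟩ := hne
      simp only [F, Finset.mem_filter, Finset.mem_univ, true_and] at h0
      obtain ⟨hE, -, ht, hf⟩ := h0
      have key : ∀ (b : Bool) (R : Finset (Fin n)), 2 * R.card ≤ n →
          (∀ i, dec D2 i = b → i ∈ R) →
          (A ∩ B).card ≤ 4 * ((A ∩ B).filter (fun v => dec D1 (σa.symm v) = b)).card →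
          2 ^ j * (F (D1, D2, E)).card ≤ n.factorial := by
        intro b R hR hRb hc
        let P := ((A ∩ B).filter (fun v => dec D1 (σa.symm v) = b)) \ E
        have hP : j ≤ P.card := by
          have : ((A ∩ B).filter (fun v => dec D1 (σa.symm v) = b)).card - E.card ≤ P.card :=
            Finset.le_card_sdiff _ _
          omega
        refine le_trans ?_ (perm_count R hR P)
        apply Nat.mul_le_mul (Nat.pow_le_pow_right (by norm_num) hP)
        apply Finset.card_le_card
        intro σ hσ
        simp only [F, Finset.mem_filter, Finset.mem_univ, true_and] at hσ ⊢
        intro v hv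
        simp only [P, Finset.mem_sdiff, Finset.mem_filter] at hv
        apply hRb
        rw [← hσ.2.1 v hv.1.1 hv.2]
        exact hv.1.2
      let R := (Finset.univ : Finset (Fin n)).filter (fun i => dec D2 i = true)
      have hRc := Finset.card_add_card_compl R
      rw [Fintype.card_fin] at hRc
      by_cases h : 2 * R.card ≤ n
      · exact key true R h (by intro i hi; simpa [R] using hi) ht
      · exact key false Rᶜ (by omega) (by intro i hi; simpa [R] using hi) (by omega)
    · rw [Finset.not_nonempty_iff_eq_empty.mp hne]
      simp
  calc _ ≤ 2 ^ j * ∑ t ∈ I, (F t).card :=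
        Nat.mul_le_mul_left _ ((Finset.card_le_card hsub).trans Finset.card_biUnion_le)
    _ = ∑ t ∈ I, 2 ^ j * (F t).card := by rw [Finset.mul_sum]
    _ ≤ ∑ t ∈ I, n.factorial := Finset.sum_le_sum (fun t _ => hF t)
    _ = _ := by
      simp only [I, Finset.sum_const, Finset.card_product, smul_eq_mul]
      ring

theorem count_total (n s j c : ℕ) (hj : 4 * (j + s) ≤ c + 1) :
    2 ^ j * ((Finset.univ : Finset (Finset (Fin n) × Finset (Fin n) ×
        Equiv.Perm (Fin n) × Equiv.Perm (Fin n))).filter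
      (fun ω => treewidth (Hgraph n ω.1 ω.2.1 ω.2.2.1 ω.2.2.2) + 1 ≤ s)).card ≤
      2 ^ j * ((smallSets n c).card * 3 ^ n * n.factorial ^ 2) +
      4 ^ n * (smallSets n (3 * s)).card ^ 3 * n.factorial ^ 2 := by
  classical
  let B1 := (Finset.univ : Finset (Finset (Fin n) × Finset (Fin n) ×
        Equiv.Perm (Fin n) × Equiv.Perm (Fin n))).filter (fun ω => (ω.1 ∩ ω.2.1).card ≤ c)
  let B2 := (Finset.univ : Finset (Finset (Fin n) × Finset (Fin n) ×
        Equiv.Perm (Fin n) × Equiv.Perm (Fin n))).filter (fun ω => c < (ω.1 ∩ ω.2.1).card ∧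
          treewidth (Hgraph n ω.1 ω.2.1 ω.2.2.1 ω.2.2.2) + 1 ≤ s)
  have hsub : (Finset.univ : Finset (Finset (Fin n) × Finset (Fin n) ×
        Equiv.Perm (Fin n) × Equiv.Perm (Fin n))).filter
      (fun ω => treewidth (Hgraph n ω.1 ω.2.1 ω.2.2.1 ω.2.2.2) + 1 ≤ s) ⊆ B1 ∪ B2 := by
    intro ω hω
    simp only [B1, B2, Finset.mem_union, Finset.mem_filter, Finset.mem_univ, true_and] at hω ⊢
    by_cases h : (ω.1 ∩ ω.2.1).card ≤ c
    · exact Or.inl h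
    · exact Or.inr ⟨by omega, hω⟩
  have h1 : B1.card ≤ (smallSets n c).card * 3 ^ n * n.factorial ^ 2 := by
    have : B1.card ≤ (((Finset.univ : Finset (Finset (Fin n) × Finset (Fin n))).filter
      (fun p => (p.1 ∩ p.2).card ≤ c)) ×ˢ
        (Finset.univ : Finset (Equiv.Perm (Fin n) × Equiv.Perm (Fin n)))).card := by
      apply Finset.card_le_card_of_injOn (fun ω => ((ω.1, ω.2.1), ω.2.2))
      · intro ω hω
        simpa [B1] using hω
      · rintro ⟨a, b, x⟩ _ ⟨a', b', x'⟩ _ h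
        simp only [Prod.mk.injEq] at h ⊢
        tauto
    rw [Finset.card_product, Finset.card_univ, Fintype.card_prod, Fintype.card_perm,
      Fintype.card_fin, ← pow_two] at this
    exact this.trans (Nat.mul_le_mul_right _ (small_inter n c))
  have h2 : 2 ^ j * B2.card ≤ 4 ^ n * (smallSets n (3 * s)).card ^ 3 * n.factorial ^ 2 := by
    have e : B2.card = ∑ A : Finset (Fin n), ∑ B : Finset (Fin n), ∑ σa : Equiv.Perm (Fin n),
        ((Finset.univ : Finset (Equiv.Perm (Fin n))).filter (fun σb => c < (A ∩ B).card ∧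
          treewidth (Hgraph n A B σa σb) + 1 ≤ s)).card := by
      simp only [B2, Finset.card_filter, Fintype.sum_prod_type]
    rw [e]
    simp only [Finset.mul_sum]
    calc _ ≤ ∑ A : Finset (Fin n), ∑ B : Finset (Fin n), ∑ σa : Equiv.Perm (Fin n),
          (smallSets n (3 * s)).card ^ 3 * n.factorial := by
          refine Finset.sum_le_sum fun A _ => Finset.sum_le_sum fun B _ =>
            Finset.sum_le_sum fun σa _ => ?_
          by_cases h : c < (A ∩ B).card
          · simp only [h, true_and]
            exact count_b A B σa s j (by omega)
          · simp [h]
      _ = _ := by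
          simp only [Finset.sum_const, Finset.card_univ, Fintype.card_perm, Fintype.card_fin,
            Fintype.card_finset, smul_eq_mul]
          rw [show (4 : ℕ) = 2 * 2 by norm_num, mul_pow]
          ring
  calc _ ≤ 2 ^ j * (B1.card + B2.card) :=
        Nat.mul_le_mul_left _ ((Finset.card_le_card hsub).trans (Finset.card_union_le _ _))
    _ = 2 ^ j * B1.card + 2 ^ j * B2.card := by ring
    _ ≤ _ := Nat.add_le_add (Nat.mul_le_mul_left _ h1) h2

/-- There is a constant `α > 0` such that, when `A` and `B` are
independent uniformly random subsets of `{x_1,…,x_n}` and `σa`, `σb` are independent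
uniformly random orderings (modeled by uniformly random permutations of `{1,…,n}`
inducing the orderings of `A` and `B`), the probability that `tw(H) < α·n` tends to
`0` as `n → ∞`. -/
theorem Hgraph_linear_treewidth_whp :
    ∃ α : ℝ, 0 < α ∧
      Filter.Tendsto
        (fun n : ℕ =>
          (Nat.card {ω : Finset (Fin n) × Finset (Fin n) ×
              Equiv.Perm (Fin n) × Equiv.Perm (Fin n) //
              (treewidth (Hgraph n ω.1 ω.2.1 ω.2.2.1 ω.2.2.2) : ℝ) < α * (n : ℝ)} : ℝ) /
            (Nat.card (Finset (Fin n) × Finset (Fin n) ×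
              Equiv.Perm (Fin n) × Equiv.Perm (Fin n)) : ℝ))
        Filter.atTop (nhds 0) := by
  classical
  obtain ⟨q1, hq1, hK1⟩ := smallSets_bound (1 / 6) (by norm_num)
  obtain ⟨ε, hε, hεN⟩ : ∃ ε : ℝ, 0 < ε ∧ (1 + ε) ^ (24 * q1) = 3 / 2 := by
    refine ⟨(3 / 2 : ℝ) ^ (((24 * q1 : ℕ) : ℝ)⁻¹) - 1, ?_, ?_⟩
    · have : (1 : ℝ) < (3 / 2 : ℝ) ^ (((24 * q1 : ℕ) : ℝ)⁻¹) :=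
        Real.one_lt_rpow (by norm_num) (by positivity)
      linarith
    · rw [add_sub_cancel]
      exact Real.rpow_inv_natCast_pow (by norm_num) (by omega)
  obtain ⟨q2, hq2, hK2⟩ := smallSets_bound ε hε
  set Q : ℕ := 8 * q1 + 3 * q2 with hQ
  have hQ0 : 0 < Q := by omega
  refine ⟨1 / (2 * Q), by positivity, ?_⟩
  have hlim : Filter.Tendsto (fun n : ℕ => (7 / 8 : ℝ) ^ n + 3 / 2 * (3 / 4 : ℝ) ^ (n / (8 * q1)))
      Filter.atTop (nhds 0) := by
    have l1 : Filter.Tendsto (fun n : ℕ => (7 / 8 : ℝ) ^ n) Filter.atTop (nhds 0) :=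
      tendsto_pow_atTop_nhds_zero_of_lt_one (by norm_num) (by norm_num)
    have l2 : Filter.Tendsto (fun n : ℕ => (3 / 4 : ℝ) ^ n) Filter.atTop (nhds 0) :=
      tendsto_pow_atTop_nhds_zero_of_lt_one (by norm_num) (by norm_num)
    have l3 := (l2.comp (Nat.tendsto_div_const_atTop (n := 8 * q1) (by omega))).const_mul (3 / 2)
    simpa using l1.add l3
  refine squeeze_zero' (Filter.Eventually.of_forall fun n => by positivity) ?_ hlim
  filter_upwards [Filter.eventually_ge_atTop (2 * Q)] with n hn
  set s := n / Q with hs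
  set c := n / q1 with hc
  set j := n / (8 * q1) with hj
  have hsQ : Q * s ≤ n := Nat.mul_div_le n Q
  have hs1 : 8 * (q1 * s) ≤ n := by nlinarith
  have hs2 : q2 * (3 * s) ≤ n := by nlinarith
  have hcq : q1 * c ≤ n := Nat.mul_div_le n q1
  have hcq2 : n < q1 * (c + 1) := Nat.lt_mul_div_succ n hq1
  have hjq : 8 * q1 * j ≤ n := Nat.mul_div_le n (8 * q1)
  have hjq2 : n < 8 * q1 * (j + 1) := Nat.lt_mul_div_succ n (by omega)
  have hmain := count_total n s j c (by
    have : q1 * (4 * (j + s)) ≤ q1 * (c + 1) := by nlinarith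
    exact Nat.le_of_mul_le_mul_left this hq1)
  have k1 := hK1 n c hcq
  have k2 := hK2 n (3 * s) hs2
  have k3 : ((smallSets n (3 * s)).card : ℝ) ^ 3 ≤ (3 / 2) ^ (j + 1) := by
    calc ((smallSets n (3 * s)).card : ℝ) ^ 3 ≤ ((1 + ε) ^ n) ^ 3 := by gcongr
      _ = (1 + ε) ^ (n * 3) := by rw [pow_mul]
      _ ≤ (1 + ε) ^ (24 * q1 * (j + 1)) := pow_le_pow_right₀ (by linarith) (by nlinarith)
      _ = _ := by rw [pow_mul, hεN]
  have htot : (Nat.card (Finset (Fin n) × Finset (Fin n) ×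
      Equiv.Perm (Fin n) × Equiv.Perm (Fin n)) : ℝ) = 4 ^ n * (n.factorial : ℝ) ^ 2 := by
    simp only [Nat.card_eq_fintype_card, Fintype.card_prod, Fintype.card_finset,
      Fintype.card_perm, Fintype.card_fin]
    push_cast
    rw [show (4 : ℝ) = 2 * 2 by norm_num, mul_pow]
    ring
  have hbad : Nat.card {ω : Finset (Fin n) × Finset (Fin n) ×
      Equiv.Perm (Fin n) × Equiv.Perm (Fin n) //
      (treewidth (Hgraph n ω.1 ω.2.1 ω.2.2.1 ω.2.2.2) : ℝ) < 1 / (2 * Q) * (n : ℝ)} ≤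
      ((Finset.univ : Finset (Finset (Fin n) × Finset (Fin n) ×
        Equiv.Perm (Fin n) × Equiv.Perm (Fin n))).filter
      (fun ω => treewidth (Hgraph n ω.1 ω.2.1 ω.2.2.1 ω.2.2.2) + 1 ≤ s)).card := by
    rw [Nat.card_eq_fintype_card, Fintype.card_subtype]
    apply Finset.card_le_card
    intro ω hω
    rw [Finset.mem_filter] at hω ⊢
    refine ⟨Finset.mem_univ _, ?_⟩
    have h := hω.2
    set w := treewidth (Hgraph n ω.1 ω.2.1 ω.2.2.1 ω.2.2.2)
    rw [one_div, inv_mul_eq_div, lt_div_iff₀ (by positivity)] at h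
    have h' : w * (2 * Q) < n := by exact_mod_cast h
    rw [hs, Nat.le_div_iff_mul_le hQ0]
    nlinarith
  rw [htot, div_le_iff₀ (by positivity)]
  set X : ℝ := (((Finset.univ : Finset (Finset (Fin n) × Finset (Fin n) ×
        Equiv.Perm (Fin n) × Equiv.Perm (Fin n))).filter
      (fun ω => treewidth (Hgraph n ω.1 ω.2.1 ω.2.2.1 ω.2.2.2) + 1 ≤ s)).card : ℝ) with hX
  have hmain' : (2 : ℝ) ^ j * X ≤
      2 ^ j * ((smallSets n c).card * 3 ^ n * (n.factorial : ℝ) ^ 2) +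
      4 ^ n * ((smallSets n (3 * s)).card : ℝ) ^ 3 * (n.factorial : ℝ) ^ 2 := by
    rw [hX]
    exact_mod_cast hmain
  refine le_trans (b := X) (by rw [hX]; exact_mod_cast hbad) ?_
  have e1 : (1 + 1 / 6 : ℝ) ^ n * 3 ^ n = (7 / 8) ^ n * 4 ^ n := by
    rw [← mul_pow, ← mul_pow]; norm_num
  have e2 : (3 / 2 : ℝ) ^ (j + 1) = 2 ^ j * (3 / 2 * (3 / 4) ^ j) := by
    rw [pow_succ, show (3 / 2 : ℝ) ^ j = 2 ^ j * (3 / 4) ^ j by rw [← mul_pow]; norm_num]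
    ring
  have h2j : (0 : ℝ) < 2 ^ j := by positivity
  refine le_of_mul_le_mul_left (hmain'.trans ?_) h2j
  calc _ ≤ 2 ^ j * ((1 + 1 / 6 : ℝ) ^ n * 3 ^ n * (n.factorial : ℝ) ^ 2) +
      4 ^ n * (3 / 2 : ℝ) ^ (j + 1) * (n.factorial : ℝ) ^ 2 := by gcongr
    _ = _ := by rw [e1, e2]; ring
end
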